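/- arXiv:1412.4978 — 7 statements merged into one kernel-verified Lean document; each statement's English description precedes it below -/
import Mathlib

section
/- The map ρ : Z¹_𝔄(𝒜,X) → Z¹(𝒜/J,X) defined by ρ(D)(a+J) = D(a) is a well-defined bijective isometry of Banach spaces; in particular, every bounded derivation D′ : 𝒜/J → X pulls back along the quotient map to an 𝔄-module derivation on 𝒜, and every 𝔄-module derivation 𝒜 → X vanishes on J. -/
noncomputable section

/-- A closed two-sided ideal of a (not necessarily unital) Banach algebra,
viewed as a closed subspace that absorbs multiplication. -/
def IsClosedIdeal {A : Type*} [NonUnitalNormedRing A] [NormedSpace ℂ A]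
    (J : Submodule ℂ A) : Prop :=
  IsClosed (J : Set A) ∧ (∀ a x : A, x ∈ J → a * x ∈ J) ∧ ∀ x a : A, x ∈ J → x * a ∈ J

/-- `J` is the smallest closed two-sided ideal containing the set `S`. -/
def IsClosedIdealGeneratedBy {A : Type*} [NonUnitalNormedRing A] [NormedSpace ℂ A]
    (J : Submodule ℂ A) (S : Set A) : Prop :=
  IsClosedIdeal J ∧ S ⊆ (J : Set A) ∧
    ∀ K : Submodule ℂ A, IsClosedIdeal K → S ⊆ (K : Set A) → J ≤ K

/-- Let `𝔄`, `A` be Banach algebras, `A` a Banach `𝔄`-bimodule with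
compatible actions, the left action trivial via a character `f` (`α · a = f α • a`) and the
right action given by `ρ`.  Let `J` be the closed ideal of `A` generated by the elements
`(a·α)b − a(α·b)`, let `q : A → B = A/J` be the quotient map onto the unital Banach algebra
`A/J`, and let `X` be a commutative Banach `A`-`𝔄`-bimodule whose left `𝔄`-action is trivial
via the same `f`.  Then every `𝔄`-module derivation `A → X` vanishes on `J`, and the map
`ρ(D)(a + J) = D(a)` is a well-defined bijective isometry from `Z¹_𝔄(A, X)` onto
`Z¹(A/J, X)`; in particular every bounded derivation `A/J → X` pulls back along `q` to an
`𝔄`-module derivation on `A`. -/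
theorem stmt_0
    {𝔄 A B X : Type*}
    [NonUnitalNormedRing 𝔄] [NormedSpace ℂ 𝔄] [IsScalarTower ℂ 𝔄 𝔄] [SMulCommClass ℂ 𝔄 𝔄]
    [CompleteSpace 𝔄]
    [NonUnitalNormedRing A] [NormedSpace ℂ A] [IsScalarTower ℂ A A] [SMulCommClass ℂ A A]
    [CompleteSpace A]
    [NormedRing B] [NormedAlgebra ℂ B] [CompleteSpace B]
    [NormedAddCommGroup X] [NormedSpace ℂ X] [CompleteSpace X]
    -- the character `f` of `𝔄`
    (f : 𝔄 →L[ℂ] ℂ) (hf_mul : ∀ α β, f (α * β) = f α * f β) (hf_ne : f ≠ 0)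
    -- the right action of `𝔄` on `A` (the left action is the trivial one `α · a = f α • a`)
    (ρ : A →L[ℂ] 𝔄 →L[ℂ] A)
    (hρ_act : ∀ a α β, ρ (ρ a α) β = ρ a (α * β))
    (hρ_mul : ∀ a b α, ρ (a * b) α = a * ρ b α)
    -- `J` is the closed ideal generated by the elements `(a·α)b − a(α·b)`
    (J : Submodule ℂ A)
    (hJ : IsClosedIdealGeneratedBy J {x | ∃ (a b : A) (α : 𝔄), x = ρ a α * b - f α • (a * b)})
    -- the quotient map `q : A → B = A/J`, `B` unital
    (q : A →L[ℂ] B) (hq_mul : ∀ a b, q (a * b) = q a * q b)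
    (hq_surj : Function.Surjective q)
    (hq_ker : ∀ a, q a = 0 ↔ a ∈ J)
    (hq_norm : ∀ a, ‖q a‖ = ⨅ j : J, ‖a + (j : A)‖)
    -- `X` is a commutative Banach `A`-`𝔄`-bimodule with trivial left `𝔄`-action via `f`
    (lX : A →L[ℂ] X →L[ℂ] X) (rX : X →L[ℂ] A →L[ℂ] X)
    (hlX : ∀ a b x, lX (a * b) x = lX a (lX b x))
    (hrX : ∀ x a b, rX (rX x a) b = rX x (a * b))
    (hlrX : ∀ a x b, rX (lX a x) b = lX a (rX x b))
    (σX : X →L[ℂ] 𝔄 →L[ℂ] X)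
    (hσX : ∀ x α, σX x α = f α • x)   -- trivial left `𝔄`-action together with commutativity
    (hcompL : ∀ a α x, f α • lX a x = lX (ρ a α) x)   -- `a·(α·x) = (a·α)·x`
    (hcompR : ∀ x a α, f α • rX x a = rX x (ρ a α))   -- `(x·a)·α = x·(a·α)`
    -- the induced `B = A/J`-module actions on `X`
    (lXB : B →L[ℂ] X →L[ℂ] X) (rXB : X →L[ℂ] B →L[ℂ] X)
    (hlXB : ∀ a x, lXB (q a) x = lX a x) (hrXB : ∀ x a, rXB x (q a) = rX x a)
    -- `Z¹_𝔄(A, X)`: bounded `𝔄`-module derivations from `A` to `X`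
    (ZA : Set (A →L[ℂ] X))
    (hZA : ZA = {D | (∀ a b, D (a * b) = lX a (D b) + rX (D a) b) ∧
      ∀ a α, D (ρ a α) = f α • D a})
    -- `Z¹(A/J, X)`: bounded derivations from `B = A/J` to `X`
    (ZB : Set (B →L[ℂ] X))
    (hZB : ZB = {D | ∀ u v, D (u * v) = lXB u (D v) + rXB (D u) v}) :
    (∀ D ∈ ZA, ∀ j ∈ J, D j = 0) ∧
    ∃ e : ZA ≃ ZB,
      (∀ D : ZA, ‖(e D : B →L[ℂ] X)‖ = ‖(D : A →L[ℂ] X)‖) ∧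
      ∀ (D : ZA) (a : A), (e D : B →L[ℂ] X) (q a) = (D : A →L[ℂ] X) a := by
  subst hZA hZB
  obtain ⟨_, hJS, hJmin⟩ := hJ
  have hvan : ∀ D : A →L[ℂ] X, (∀ a b, D (a * b) = lX a (D b) + rX (D a) b) →
      (∀ a α, D (ρ a α) = f α • D a) → ∀ j ∈ J, D j = 0 := by
    intro D hD hDρ j hj
    let K : Submodule ℂ A :=
      { carrier := {x | D x = 0 ∧ lX x = 0 ∧ ∀ y, rX y x = 0}
        zero_mem' := by simp
        add_mem' := by
          rintro x y ⟨h1, h2, h3⟩ ⟨k1, k2, k3⟩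
          refine ⟨by simp [h1, k1], by simp [h2, k2], fun z => by simp [h3, k3]⟩
        smul_mem' := by
          rintro c x ⟨h1, h2, h3⟩
          refine ⟨by simp [h1], by simp [h2], fun z => by simp [h3]⟩ }
    have hK : IsClosedIdeal K := by
      refine ⟨?_, ?_, ?_⟩
      · have : (K : Set A) = {x | D x = 0} ∩ ({x | lX x = 0} ∩ ⋂ y, {x | rX y x = 0}) := by
          ext x
          simp [K]
        rw [this]
        refine (isClosed_eq D.continuous continuous_const).inter
          ((isClosed_eq lX.continuous continuous_const).inter
            (isClosed_iInter fun y => isClosed_eq (rX y).continuous continuous_const))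
      · rintro a x ⟨h1, h2, h3⟩
        refine ⟨by rw [hD, h1, h3]; simp, ?_, fun y => by rw [← hrX, h3]⟩
        ext y
        rw [hlX, h2]; simp
      · rintro x a ⟨h1, h2, h3⟩
        refine ⟨by rw [hD, h1, h2]; simp, ?_, fun y => by rw [← hrX, h3]; simp⟩
        ext y
        rw [hlX, h2]; simp
    have hS : {x | ∃ (a b : A) (α : 𝔄), x = ρ a α * b - f α • (a * b)} ⊆ (K : Set A) := by
      rintro x ⟨a, b, α, rfl⟩
      refine ⟨?_, ?_, fun y => ?_⟩
      · rw [map_sub, map_smul, hD, hD, hDρ, ← hcompL]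
        simp
      · ext y
        rw [map_sub, map_smul, ContinuousLinearMap.sub_apply, ContinuousLinearMap.smul_apply,
          hlX, hlX, ← hcompL]
        simp
      · rw [map_sub, map_smul, ← hrX, ← hrX, ← hcompR]
        simp
    exact (hJmin K hK hS hj).1
  have hqρ : ∀ a α, q (ρ a α) = f α • q a := by
    intro a α
    obtain ⟨e, he⟩ := hq_surj 1
    have h := (hq_ker _).2 (hJS ⟨a, e, α, rfl⟩)
    rw [map_sub, map_smul, hq_mul, hq_mul, he, mul_one, mul_one] at h
    exact sub_eq_zero.1 h
  have hqle : ∀ a, ‖q a‖ ≤ ‖a‖ := by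
    intro a
    rw [hq_norm]
    refine (ciInf_le ⟨0, ?_⟩ (0 : J)).trans (by simp)
    rintro _ ⟨j, rfl⟩
    exact norm_nonneg _
  have hbd : ∀ D : A →L[ℂ] X, (∀ j ∈ J, D j = 0) → ∀ a, ‖D a‖ ≤ ‖D‖ * ‖q a‖ := by
    intro D hD a
    rw [hq_norm, Real.mul_iInf_of_nonneg (norm_nonneg _)]
    refine le_ciInf fun j => ?_
    have : D a = D (a + j) := by rw [map_add, hD j j.2, add_zero]
    rw [this]
    exact D.le_opNorm _
  refine ⟨fun D hD => hvan D hD.1 hD.2, ?_⟩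
  let g : {D : B →L[ℂ] X | ∀ u v, D (u * v) = lXB u (D v) + rXB (D u) v} →
      {D : A →L[ℂ] X | (∀ a b, D (a * b) = lX a (D b) + rX (D a) b) ∧
        ∀ a α, D (ρ a α) = f α • D a} := fun D =>
    ⟨D.1.comp q, fun a b => by
      simp only [ContinuousLinearMap.comp_apply]
      rw [hq_mul, D.2, hlXB, hrXB], fun a α => by
      simp only [ContinuousLinearMap.comp_apply]
      rw [hqρ, map_smul]⟩
  have hgapp : ∀ D a, (g D).1 a = D.1 (q a) := fun D a => rfl
  have hgnorm : ∀ D, ‖(g D).1‖ = ‖D.1‖ := by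
    intro D
    apply le_antisymm
    · refine ContinuousLinearMap.opNorm_le_bound _ (norm_nonneg _) fun a => ?_
      rw [hgapp]
      exact (D.1.le_opNorm _).trans (mul_le_mul_of_nonneg_left (hqle a) (norm_nonneg _))
    · refine ContinuousLinearMap.opNorm_le_bound _ (norm_nonneg _) fun u => ?_
      obtain ⟨a, rfl⟩ := hq_surj u
      rw [← hgapp]
      exact hbd _ (hvan _ (g D).2.1 (g D).2.2) a
  have hgbij : Function.Bijective g := by
    constructor
    · intro D E h
      apply Subtype.ext
      ext u
      obtain ⟨a, rfl⟩ := hq_surj u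
      rw [← hgapp, ← hgapp, h]
    · intro D
      have hv := hvan D.1 D.2.1 D.2.2
      have hwd : ∀ a b, q a = q b → D.1 a = D.1 b := by
        intro a b h
        rw [← sub_eq_zero, ← map_sub]
        apply hv
        rw [← hq_ker, map_sub, h, sub_self]
      choose s hs using hq_surj
      let L : B →ₗ[ℂ] X :=
        { toFun := fun u => D.1 (s u)
          map_add' := fun u v => by
            rw [← map_add]
            exact hwd _ _ (by simp [hs])
          map_smul' := fun c u => by
            rw [RingHom.id_apply, ← map_smul]
            exact hwd _ _ (by simp [hs]) }
      let E : B →L[ℂ] X := L.mkContinuous ‖D.1‖ fun u => by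
        have := hbd D.1 hv (s u)
        rwa [hs] at this
      have hE : ∀ a, E (q a) = D.1 a := fun a => hwd _ _ (hs _)
      refine ⟨⟨E, fun u v => ?_⟩, ?_⟩
      · rw [← hs u, ← hs v, ← hq_mul, hE, hE, hE, hlXB, hrXB]
        exact D.2.1 _ _
      · apply Subtype.ext
        ext a
        exact hE a
  refine ⟨(Equiv.ofBijective g hgbij).symm, fun D => ?_, fun D a => ?_⟩
  · rw [← hgnorm]
    exact congrArg (fun E => ‖E.1‖) ((Equiv.ofBijective g hgbij).apply_symm_apply D)
  · rw [← hgapp]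
    exact congrArg (fun E => E.1 a) ((Equiv.ofBijective g hgbij).apply_symm_apply D)
end
end

section
/- The map Φ sending D + B¹_𝔄(𝒜,X) to ρ(D) + B¹(𝒜/J,X), where ρ(D)(a+J) = D(a), is a well-defined bijection H¹_𝔄(𝒜,X) → H¹(𝒜/J,X) that is isometric with respect to the quotient seminorms; in particular the first module cohomology group of 𝒜 with coefficients in X and the first Hochschild cohomology group of 𝒜/J with coefficients in X are isomorphic as seminormed spaces. -/
noncomputable section

/-- In the setting of the previous statement, the map `Φ` sending
`D + B¹_𝔄(A,X)` to `ρ(D) + B¹(A/J,X)`, where `ρ(D)(a+J) = D(a)`, is a well-defined bijection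
`H¹_𝔄(A,X) → H¹(A/J,X)` which is isometric for the quotient seminorms: the bijection
`ρ : Z¹_𝔄(A,X) ≃ Z¹(A/J,X)` matches inner derivations with inner derivations and preserves
the distance to the space of inner derivations.  In particular the first module cohomology
group of `A` with coefficients in `X` and the first Hochschild cohomology group of `A/J`
with coefficients in `X` are isomorphic as seminormed spaces. -/
theorem stmt_1
    {𝔄 A B X : Type*}
    [NonUnitalNormedRing 𝔄] [NormedSpace ℂ 𝔄] [IsScalarTower ℂ 𝔄 𝔄] [SMulCommClass ℂ 𝔄 𝔄]
    [CompleteSpace 𝔄]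
    [NonUnitalNormedRing A] [NormedSpace ℂ A] [IsScalarTower ℂ A A] [SMulCommClass ℂ A A]
    [CompleteSpace A]
    [NormedRing B] [NormedAlgebra ℂ B] [CompleteSpace B]
    [NormedAddCommGroup X] [NormedSpace ℂ X] [CompleteSpace X]
    -- the character `f` of `𝔄`
    (f : 𝔄 →L[ℂ] ℂ) (hf_mul : ∀ α β, f (α * β) = f α * f β) (hf_ne : f ≠ 0)
    -- the right action of `𝔄` on `A` (the left action is the trivial one `α · a = f α • a`)
    (ρ : A →L[ℂ] 𝔄 →L[ℂ] A)
    (hρ_act : ∀ a α β, ρ (ρ a α) β = ρ a (α * β))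
    (hρ_mul : ∀ a b α, ρ (a * b) α = a * ρ b α)
    -- `J` is the closed ideal generated by the elements `(a·α)b − a(α·b)`
    (J : Submodule ℂ A)
    (hJ : IsClosedIdealGeneratedBy J {x | ∃ (a b : A) (α : 𝔄), x = ρ a α * b - f α • (a * b)})
    -- the quotient map `q : A → B = A/J`, `B` unital
    (q : A →L[ℂ] B) (hq_mul : ∀ a b, q (a * b) = q a * q b)
    (hq_surj : Function.Surjective q)
    (hq_ker : ∀ a, q a = 0 ↔ a ∈ J)
    (hq_norm : ∀ a, ‖q a‖ = ⨅ j : J, ‖a + (j : A)‖)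
    -- `X` is a commutative Banach `A`-`𝔄`-bimodule with trivial left `𝔄`-action via `f`
    (lX : A →L[ℂ] X →L[ℂ] X) (rX : X →L[ℂ] A →L[ℂ] X)
    (hlX : ∀ a b x, lX (a * b) x = lX a (lX b x))
    (hrX : ∀ x a b, rX (rX x a) b = rX x (a * b))
    (hlrX : ∀ a x b, rX (lX a x) b = lX a (rX x b))
    (σX : X →L[ℂ] 𝔄 →L[ℂ] X)
    (hσX : ∀ x α, σX x α = f α • x)   -- trivial left `𝔄`-action together with commutativity
    (hcompL : ∀ a α x, f α • lX a x = lX (ρ a α) x)   -- `a·(α·x) = (a·α)·x`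
    (hcompR : ∀ x a α, f α • rX x a = rX x (ρ a α))   -- `(x·a)·α = x·(a·α)`
    -- the induced `B = A/J`-module actions on `X`
    (lXB : B →L[ℂ] X →L[ℂ] X) (rXB : X →L[ℂ] B →L[ℂ] X)
    (hlXB : ∀ a x, lXB (q a) x = lX a x) (hrXB : ∀ x a, rXB x (q a) = rX x a)
    -- `Z¹_𝔄(A, X)`: bounded `𝔄`-module derivations from `A` to `X`
    (ZA : Set (A →L[ℂ] X))
    (hZA : ZA = {D | (∀ a b, D (a * b) = lX a (D b) + rX (D a) b) ∧
      ∀ a α, D (ρ a α) = f α • D a})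
    -- `Z¹(A/J, X)`: bounded derivations from `B = A/J` to `X`
    (ZB : Set (B →L[ℂ] X))
    (hZB : ZB = {D | ∀ u v, D (u * v) = lXB u (D v) + rXB (D u) v}) :
    ∃ e : ZA ≃ ZB,
      (∀ (D : ZA) (a : A), (e D : B →L[ℂ] X) (q a) = (D : A →L[ℂ] X) a) ∧
      (∀ D : ZA, (∃ x : X, (D : A →L[ℂ] X) = lX.flip x - rX x) ↔
        ∃ x : X, (e D : B →L[ℂ] X) = lXB.flip x - rXB x) ∧
      ∀ D : ZA, (⨅ x : X, ‖(D : A →L[ℂ] X) - (lX.flip x - rX x)‖) =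
        ⨅ x : X, ‖(e D : B →L[ℂ] X) - (lXB.flip x - rXB x)‖ := by
  obtain ⟨⟨hJc, hJl, hJr⟩, hJS, hJmin⟩ := hJ
  have hbdd : ∀ a : A, BddBelow (Set.range fun j : J => ‖a + (j : A)‖) := fun a =>
    ⟨0, by rintro _ ⟨j, rfl⟩; exact norm_nonneg _⟩
  have hq_le : ∀ a, ‖q a‖ ≤ ‖a‖ := by
    intro a
    rw [hq_norm]
    simpa using ciInf_le (hbdd a) (0 : J)
  -- a factorisation through `q` keeps every bound
  have hbound : ∀ (D : A →L[ℂ] X), (∀ a, a ∈ J → D a = 0) → ∀ a, ‖D a‖ ≤ ‖D‖ * ‖q a‖ := by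
    intro D hD a
    rw [hq_norm, Real.mul_iInf_of_nonneg (norm_nonneg _)]
    refine le_ciInf fun j => ?_
    have h1 : D a = D (a + (j : A)) := by rw [map_add, hD _ j.2, add_zero]
    rw [h1]
    exact D.le_opNorm _
  have hnorm : ∀ T : B →L[ℂ] X, ‖T.comp q‖ = ‖T‖ := by
    intro T
    apply le_antisymm
    · refine ContinuousLinearMap.opNorm_le_bound _ (norm_nonneg _) fun a => ?_
      exact (T.le_opNorm (q a)).trans
        (mul_le_mul_of_nonneg_left (hq_le a) (norm_nonneg _))
    · refine ContinuousLinearMap.opNorm_le_bound _ (norm_nonneg _) fun b => ?_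
      obtain ⟨a, rfl⟩ := hq_surj b
      refine hbound (T.comp q) (fun j hj => ?_) a
      simp [(hq_ker j).2 hj]
  have hinj : ∀ T S : B →L[ℂ] X, T.comp q = S.comp q → T = S := by
    intro T S h
    ext b
    obtain ⟨a, rfl⟩ := hq_surj b
    exact DFunLike.congr_fun h a
  have had : ∀ x, (lXB.flip x - rXB x).comp q = lX.flip x - rX x := by
    intro x
    ext a
    simp [hlXB, hrXB]
  -- derivations vanish on `J`
  have hvan : ∀ D ∈ ZA, ∀ a, a ∈ J → D a = 0 := by
    intro D hD
    rw [hZA] at hD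
    obtain ⟨hD1, hD2⟩ := hD
    have hK : J ≤ J ⊓ LinearMap.ker (D : A →ₗ[ℂ] X) := by
      apply hJmin
      · refine ⟨?_, ?_, ?_⟩
        · have : IsClosed {a : A | D a = 0} := isClosed_eq D.continuous continuous_const
          exact hJc.inter this
        · rintro a x ⟨hx, hx0⟩
          have hx0 : D x = 0 := hx0
          refine ⟨hJl a x hx, ?_⟩
          change D (a * x) = 0
          rw [hD1, hx0, ← hrXB, (hq_ker x).2 hx]
          simp
        · rintro x a ⟨hx, hx0⟩
          have hx0 : D x = 0 := hx0
          refine ⟨hJr x a hx, ?_⟩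
          change D (x * a) = 0
          rw [hD1, hx0, ← hlXB, (hq_ker x).2 hx]
          simp
      · rintro _ ⟨a, b, α, rfl⟩
        refine ⟨hJS ⟨a, b, α, rfl⟩, ?_⟩
        change D (ρ a α * b - f α • (a * b)) = 0
        rw [map_sub, map_smul, hD1, hD1, hD2, ← hcompL]
        simp
    exact fun a ha => (hK ha).2
  have hqρ : ∀ a α, q (ρ a α) = f α • q a := by
    intro a α
    obtain ⟨b, hb⟩ := hq_surj 1
    have h := (hq_ker _).2 (hJS ⟨a, b, α, rfl⟩)
    rw [map_sub, map_smul, hq_mul, hq_mul, hb, mul_one, mul_one] at h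
    exact sub_eq_zero.1 h
  have hpull : ∀ T ∈ ZB, T.comp q ∈ ZA := by
    intro T hT
    rw [hZB] at hT
    rw [hZA]
    refine ⟨fun a b => ?_, fun a α => ?_⟩
    · have := hT (q a) (q b)
      simpa [hq_mul, hlXB, hrXB] using this
    · simp [hqρ]
  have hpush : ∀ D ∈ ZA, ∃ T ∈ ZB, T.comp q = D := by
    intro D hD
    have hv := hvan D hD
    have hs := Function.surjInv_eq hq_surj
    have key : ∀ a a', q a = q a' → D a = D a' := by
      intro a a' h
      rw [← sub_eq_zero, ← map_sub]
      exact hv _ ((hq_ker _).1 (by rw [map_sub, h, sub_self]))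
    let L : B →ₗ[ℂ] X :=
      { toFun := fun b => D (Function.surjInv hq_surj b)
        map_add' := fun b c => by
          rw [← map_add]
          apply key
          rw [map_add, hs, hs, hs]
        map_smul' := fun r b => by
          rw [RingHom.id_apply, ← map_smul]
          apply key
          rw [map_smul, hs, hs] }
    let T : B →L[ℂ] X := L.mkContinuous ‖D‖ fun b => by
      have := hbound D hv (Function.surjInv hq_surj b)
      rw [hs] at this
      exact this
    have hT : ∀ a, T (q a) = D a := fun a => key _ _ (hs _)
    refine ⟨T, ?_, ?_⟩
    · rw [hZA] at hD
      rw [hZB]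
      intro u v
      obtain ⟨a, rfl⟩ := hq_surj u
      obtain ⟨b, rfl⟩ := hq_surj v
      rw [← hq_mul, hT, hT, hT, hlXB, hrXB, hD.1]
    · ext a
      exact hT a
  let g : ZB → ZA := fun T => ⟨T.1.comp q, hpull T.1 T.2⟩
  have hg : Function.Bijective g := by
    constructor
    · intro T S h
      exact Subtype.ext (hinj _ _ (congrArg Subtype.val h))
    · rintro ⟨D, hD⟩
      obtain ⟨T, hT, h⟩ := hpush D hD
      exact ⟨⟨T, hT⟩, Subtype.ext h⟩
  let e := (Equiv.ofBijective g hg).symm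
  have he : ∀ D : ZA, (e D : B →L[ℂ] X).comp q = D := fun D =>
    congrArg Subtype.val ((Equiv.ofBijective g hg).apply_symm_apply D)
  refine ⟨e, fun D a => DFunLike.congr_fun (he D) a, fun D => ?_, fun D => ?_⟩
  · refine exists_congr fun x => ?_
    rw [← he D, ← had x]
    exact ⟨fun h => by simpa [he] using hinj _ _ (by simpa [he] using h), fun h => by rw [h]⟩
  · refine iInf_congr fun x => ?_
    rw [← hnorm, ContinuousLinearMap.sub_comp, he, had]
end
end

section
/- Assume J = J₀ and X is an 𝓛₁-space. Then the Banach spaces (𝒜/J) ⊗̂ X and (𝒜 ⊗̂ X)/I₀ are isometrically isomorphic, via the map induced by q ⊗ id, where q : 𝒜 → 𝒜/J is the quotient map; equivalently, the module projective tensor product 𝒜 ⊗̂_𝔄 X is isometrically isomorphic to (𝒜/J) ⊗̂ X. -/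
noncomputable section

universe u

/-- `X` is an `𝓛₁`-space: for some `λ > 1`, every finite-dimensional subspace of `X` is
contained in a finite-dimensional subspace `N` whose Banach–Mazur distance from
`ℓ¹(dim N)` is at most `λ`. -/
def IsL1Space (X : Type*) [NormedAddCommGroup X] [NormedSpace ℂ X] : Prop :=
  ∃ lam : ℝ, 1 < lam ∧ ∀ M : Submodule ℂ X, FiniteDimensional ℂ M →
    ∃ N : Submodule ℂ X, FiniteDimensional ℂ N ∧ M ≤ N ∧
      ∃ T : N ≃L[ℂ] PiLp 1 (fun _ : Fin (Module.finrank ℂ N) => ℂ),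
        ‖(T : N →L[ℂ] PiLp 1 (fun _ : Fin (Module.finrank ℂ N) => ℂ))‖ *
          ‖(T.symm : PiLp 1 (fun _ : Fin (Module.finrank ℂ N) => ℂ) →L[ℂ] N)‖ ≤ lam

/-- `(T, ι)` is (a realization of) the projective tensor product `E ⊗̂ F` of the Banach
spaces `E` and `F`. -/
def IsProjectiveTensorProduct (E F T : Type*)
    [NormedAddCommGroup E] [NormedSpace ℂ E] [NormedAddCommGroup F] [NormedSpace ℂ F]
    [NormedAddCommGroup T] [NormedSpace ℂ T] [CompleteSpace T]
    (ι : E →L[ℂ] F →L[ℂ] T) : Prop :=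
  (∀ e f, ‖ι e f‖ ≤ ‖e‖ * ‖f‖) ∧
  Dense ((Submodule.span ℂ {t : T | ∃ e f, t = ι e f} : Submodule ℂ T) : Set T) ∧
  ∀ (Y : Type u) [NormedAddCommGroup Y] [NormedSpace ℂ Y] [CompleteSpace Y]
    (φ : E →L[ℂ] F →L[ℂ] Y),
    ∃ ψ : T →L[ℂ] Y, (∀ e f, ψ (ι e f) = φ e f) ∧ ‖ψ‖ = ‖φ‖

open scoped TensorProduct

/-- Scalar universal property of the projective tensor product, freed from universe levels. -/
theorem IsProjectiveTensorProduct.exists_scalar {E F T : Type*}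
    [NormedAddCommGroup E] [NormedSpace ℂ E] [NormedAddCommGroup F] [NormedSpace ℂ F]
    [NormedAddCommGroup T] [NormedSpace ℂ T] [CompleteSpace T]
    {ι : E →L[ℂ] F →L[ℂ] T} (h : IsProjectiveTensorProduct.{u} E F T ι)
    (φ : E →ₗ[ℂ] F →ₗ[ℂ] ℂ) (hφ : ∀ e f, ‖φ e f‖ ≤ ‖e‖ * ‖f‖) :
    ∃ ψ : T →L[ℂ] ℂ, (∀ e f, ψ (ι e f) = φ e f) ∧ ∀ t, ‖ψ t‖ ≤ ‖t‖ := by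
  let U : ULift.{u} ℂ ≃ₗᵢ[ℂ] ℂ := LinearIsometryEquiv.ulift ℂ ℂ
  let φ' : E →ₗ[ℂ] F →ₗ[ℂ] ULift.{u} ℂ :=
    φ.compr₂ (U.symm.toLinearEquiv : ℂ →ₗ[ℂ] ULift.{u} ℂ)
  have hb : ∀ e f, ‖φ' e f‖ ≤ 1 * ‖e‖ * ‖f‖ := by
    intro e f
    have : φ' e f = U.symm (φ e f) := rfl
    rw [this, LinearIsometryEquiv.norm_map, one_mul]
    exact hφ e f
  obtain ⟨ψ, h1, h2⟩ := h.2.2 (ULift.{u} ℂ) (φ'.mkContinuous₂ 1 hb)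
  refine ⟨(U.toContinuousLinearEquiv : ULift.{u} ℂ →L[ℂ] ℂ).comp ψ, ?_, ?_⟩
  · intro e f
    have : ψ (ι e f) = U.symm (φ e f) := by rw [h1]; rfl
    simp [this]
  · intro t
    have h3 : ‖ψ‖ ≤ 1 := by
      rw [h2]; exact LinearMap.mkContinuous₂_norm_le _ zero_le_one _
    have h4 : ‖ψ t‖ ≤ 1 * ‖t‖ := ψ.le_of_opNorm_le h3 t
    simpa using h4

theorem quot_norm_le_of_forall {E : Type*} [NormedAddCommGroup E] [NormedSpace ℂ E]
    (J : Submodule ℂ E) (c : ℝ) (a : E) (h : ∀ j ∈ J, c ≤ ‖a + j‖) :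
    c ≤ ⨅ j : J, ‖a + (j : E)‖ :=
  le_ciInf fun j => h j j.2

theorem quot_norm_le {E : Type*} [NormedAddCommGroup E] [NormedSpace ℂ E]
    (J : Submodule ℂ E) (a : E) : ⨅ j : J, ‖a + (j : E)‖ ≤ ‖a‖ := by
  have hb : BddBelow (Set.range fun j : J => ‖a + (j : E)‖) :=
    ⟨0, by rintro _ ⟨j, rfl⟩; exact norm_nonneg _⟩
  simpa using ciInf_le hb (0 : J)

theorem denseRange_lift {E F T : Type*}
    [NormedAddCommGroup E] [NormedSpace ℂ E] [NormedAddCommGroup F] [NormedSpace ℂ F]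
    [NormedAddCommGroup T] [NormedSpace ℂ T]
    (P : TensorProduct ℂ E F →ₗ[ℂ] T) (S : Set T)
    (hS : Dense ((Submodule.span ℂ S : Submodule ℂ T) : Set T))
    (h : ∀ t ∈ S, ∃ z, P z = t) : DenseRange P := by
  refine hS.mono ?_
  have : Submodule.span ℂ S ≤ LinearMap.range P := Submodule.span_le.2 h
  exact this

theorem vanish_closure {E : Type*} [NormedAddCommGroup E] [NormedSpace ℂ E]
    {G : Type*} [NormedAddCommGroup G] [NormedSpace ℂ G] (ψ : E →L[ℂ] G) (S : Set E)
    (h : ∀ t ∈ S, ψ t = 0) : ∀ t ∈ (Submodule.span ℂ S).topologicalClosure, ψ t = 0 := by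
  have : (Submodule.span ℂ S).topologicalClosure ≤ LinearMap.ker (ψ : E →ₗ[ℂ] G) := by
    refine Submodule.topologicalClosure_minimal _ (Submodule.span_le.2 h) ?_
    exact ψ.isClosed_ker
  exact this

/-- In the standing setting (trivial left `𝔄`-actions via the character
`f`, `A/J` unital), assume `J = J₀` (the closed linear span of the elements `a·α − f(α)a`)
and that `X` is an `𝓛₁`-space.  Then the Banach spaces `(A/J) ⊗̂ X` and `(A ⊗̂ X)/I₀` are
isometrically isomorphic via the map induced by `q ⊗ id`; equivalently, the module
projective tensor product `A ⊗̂_𝔄 X = (A ⊗̂ X)/I₀` is isometrically isomorphic to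
`(A/J) ⊗̂ X`. -/
theorem stmt_3
    {𝔄 A B X : Type*}
    [NonUnitalNormedRing 𝔄] [NormedSpace ℂ 𝔄] [IsScalarTower ℂ 𝔄 𝔄] [SMulCommClass ℂ 𝔄 𝔄]
    [CompleteSpace 𝔄]
    [NonUnitalNormedRing A] [NormedSpace ℂ A] [IsScalarTower ℂ A A] [SMulCommClass ℂ A A]
    [CompleteSpace A]
    [NormedRing B] [NormedAlgebra ℂ B] [CompleteSpace B]
    [NormedAddCommGroup X] [NormedSpace ℂ X] [CompleteSpace X]
    -- the character `f` of `𝔄`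
    (f : 𝔄 →L[ℂ] ℂ) (hf_mul : ∀ α β, f (α * β) = f α * f β) (hf_ne : f ≠ 0)
    -- the right action of `𝔄` on `A` (the left action is the trivial one `α · a = f α • a`)
    (ρ : A →L[ℂ] 𝔄 →L[ℂ] A)
    (hρ_act : ∀ a α β, ρ (ρ a α) β = ρ a (α * β))
    (hρ_mul : ∀ a b α, ρ (a * b) α = a * ρ b α)
    -- `J` is the closed ideal generated by the elements `(a·α)b − a(α·b)`
    (J : Submodule ℂ A)
    (hJ : IsClosedIdealGeneratedBy J {x | ∃ (a b : A) (α : 𝔄), x = ρ a α * b - f α • (a * b)})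
    -- the assumption `J = J₀`
    (hJ0 : J = (Submodule.span ℂ {x : A | ∃ (a : A) (α : 𝔄), x = ρ a α - f α • a}).topologicalClosure)
    -- the quotient map `q : A → B = A/J`, `B` unital
    (q : A →L[ℂ] B) (hq_mul : ∀ a b, q (a * b) = q a * q b)
    (hq_surj : Function.Surjective q)
    (hq_ker : ∀ a, q a = 0 ↔ a ∈ J)
    (hq_norm : ∀ a, ‖q a‖ = ⨅ j : J, ‖a + (j : A)‖)
    -- `X` is a commutative Banach `A`-`𝔄`-bimodule with trivial left `𝔄`-action via `f`,
    -- and an `𝓛₁`-space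
    (lX : A →L[ℂ] X →L[ℂ] X) (rX : X →L[ℂ] A →L[ℂ] X)
    (hlX : ∀ a b x, lX (a * b) x = lX a (lX b x))
    (hrX : ∀ x a b, rX (rX x a) b = rX x (a * b))
    (hlrX : ∀ a x b, rX (lX a x) b = lX a (rX x b))
    (σX : X →L[ℂ] 𝔄 →L[ℂ] X)
    (hσX : ∀ x α, σX x α = f α • x)
    (hcompL : ∀ a α x, f α • lX a x = lX (ρ a α) x)
    (hcompR : ∀ x a α, f α • rX x a = rX x (ρ a α))
    (hX1 : IsL1Space X)
    -- `TAX = A ⊗̂ X`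
    {TAX : Type*} [NormedAddCommGroup TAX] [NormedSpace ℂ TAX] [CompleteSpace TAX]
    (ιA : A →L[ℂ] X →L[ℂ] TAX) (hTAX : IsProjectiveTensorProduct.{u} A X TAX ιA)
    -- `TBX = (A/J) ⊗̂ X`
    {TBX : Type*} [NormedAddCommGroup TBX] [NormedSpace ℂ TBX] [CompleteSpace TBX]
    (ιB : B →L[ℂ] X →L[ℂ] TBX) (hTBX : IsProjectiveTensorProduct.{u} B X TBX ιB)
    -- `I₀` : the closed linear span of the elements `a·α ⊗ x − a ⊗ α·x`
    (I₀ : Submodule ℂ TAX)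
    (hI₀ : I₀ = (Submodule.span ℂ
      {t : TAX | ∃ (a : A) (α : 𝔄) (x : X), t = ιA (ρ a α) x - f α • ιA a x}).topologicalClosure)
    -- `Q = (A ⊗̂ X)/I₀ = A ⊗̂_𝔄 X` with quotient map `qT`
    {Q : Type*} [NormedAddCommGroup Q] [NormedSpace ℂ Q] [CompleteSpace Q]
    (qT : TAX →L[ℂ] Q) (hqT_surj : Function.Surjective qT)
    (hqT_ker : ∀ t, qT t = 0 ↔ t ∈ I₀)
    (hqT_norm : ∀ t, ‖qT t‖ = ⨅ s : I₀, ‖t + (s : TAX)‖) :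
    -- conclusion: `(A ⊗̂ X)/I₀ ≅ (A/J) ⊗̂ X` isometrically, via the map induced by `q ⊗ id`
    ∃ e : Q ≃ₗᵢ[ℂ] TBX, ∀ (a : A) (x : X), e (qT (ιA a x)) = ιB (q a) x := by
  -- `q` and `qT` are contractive
  have hq_le : ∀ a, ‖q a‖ ≤ ‖a‖ := fun a => (hq_norm a).trans_le (quot_norm_le J a)
  have hqT_le : ∀ t, ‖qT t‖ ≤ ‖t‖ := fun t => (hqT_norm t).trans_le (quot_norm_le I₀ t)
  have hqρ : ∀ a α, q (ρ a α) = f α • q a := by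
    intro a α
    have : ρ a α - f α • a ∈ J := by
      rw [hJ0]
      exact Submodule.le_topologicalClosure _ (Submodule.subset_span ⟨a, α, rfl⟩)
    have := (hq_ker _).2 this
    rwa [map_sub, map_smul, sub_eq_zero] at this
  let bA : A →ₗ[ℂ] X →ₗ[ℂ] TAX := ContinuousLinearMap.toLinearMap₁₂ ιA
  let bB : B →ₗ[ℂ] X →ₗ[ℂ] TBX := ContinuousLinearMap.toLinearMap₁₂ ιB
  let PA : TensorProduct ℂ A X →ₗ[ℂ] TAX := TensorProduct.lift bA
  let P1 : TensorProduct ℂ A X →ₗ[ℂ] Q := (qT : TAX →ₗ[ℂ] Q) ∘ₗ PA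
  let P2 : TensorProduct ℂ A X →ₗ[ℂ] TBX := TensorProduct.lift (bB ∘ₗ (q : A →ₗ[ℂ] B))
  have hPA : ∀ a x, PA (a ⊗ₜ[ℂ] x) = ιA a x := fun a x => TensorProduct.lift.tmul _ _
  have hP1 : ∀ z, P1 z = qT (PA z) := fun z => rfl
  have hP2 : ∀ a x, P2 (a ⊗ₜ[ℂ] x) = ιB (q a) x := fun a x => TensorProduct.lift.tmul _ _
  have d1 : DenseRange P1 := by
    have hd : DenseRange PA := denseRange_lift PA _ hTAX.2.1 (by
      rintro _ ⟨a, x, rfl⟩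
      exact ⟨a ⊗ₜ[ℂ] x, hPA a x⟩)
    exact hqT_surj.denseRange.comp hd qT.continuous
  have d2 : DenseRange P2 := denseRange_lift P2 _ hTBX.2.1 (by
    rintro _ ⟨b, x, rfl⟩
    obtain ⟨a, rfl⟩ := hq_surj b
    exact ⟨a ⊗ₜ[ℂ] x, hP2 a x⟩)
  -- first inequality
  have hle1 : ∀ z, ‖P2 z‖ ≤ ‖P1 z‖ := by
    intro z
    obtain ⟨g, hg1, hg2⟩ := exists_dual_vector'' ℂ (P2 z)
    have hgle : ∀ t, ‖g t‖ ≤ ‖t‖ := fun t => by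
      simpa using g.le_of_opNorm_le hg1 t
    obtain ⟨ψ, h1, h2⟩ := hTAX.exists_scalar
      ((bB ∘ₗ (q : A →ₗ[ℂ] B)).compr₂ (g : TBX →ₗ[ℂ] ℂ)) (by
        intro a x
        calc ‖g (ιB (q a) x)‖ ≤ ‖ιB (q a) x‖ := hgle _
          _ ≤ ‖q a‖ * ‖x‖ := hTBX.1 _ _
          _ ≤ ‖a‖ * ‖x‖ := by gcongr; exact hq_le a)
    have h1' : ∀ a x, ψ (ιA a x) = g (ιB (q a) x) := h1
    have hv : ∀ s ∈ I₀, ψ s = 0 := by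
      rw [hI₀]
      refine vanish_closure ψ _ ?_
      rintro _ ⟨a, α, x, rfl⟩
      simp [h1', hqρ]
    have heq : ∀ z, ψ (PA z) = g (P2 z) := by
      intro z
      induction z using TensorProduct.induction_on with
      | zero => simp
      | tmul a x => rw [hPA, hP2, h1']
      | add z w hz hw => simp only [map_add, hz, hw]
    have hn : ‖P2 z‖ = ‖ψ (PA z)‖ := by
      rw [heq, hg2]; simp
    rw [hn, hP1, hqT_norm]
    refine quot_norm_le_of_forall _ _ _ fun s hs => ?_
    have := h2 (PA z + s)
    rwa [map_add, hv s hs, add_zero] at this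
  -- second inequality
  have hle2 : ∀ z, ‖P1 z‖ ≤ ‖P2 z‖ := by
    intro z
    obtain ⟨g, hg1, hg2⟩ := exists_dual_vector'' ℂ (P1 z)
    have hgle : ∀ t, ‖g t‖ ≤ ‖t‖ := fun t => by
      simpa using g.le_of_opNorm_le hg1 t
    have hv : ∀ x, ∀ a ∈ J, g (qT (ιA a x)) = 0 := by
      intro x
      rw [hJ0]
      refine vanish_closure ((g.comp qT).comp (ιA.flip x)) _ ?_
      rintro _ ⟨a, α, rfl⟩
      have : qT (ιA (ρ a α) x - f α • ιA a x) = 0 := by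
        rw [hqT_ker, hI₀]
        exact Submodule.le_topologicalClosure _ (Submodule.subset_span ⟨a, α, x, rfl⟩)
      have h' : ιA (ρ a α - f α • a) x = ιA (ρ a α) x - f α • ιA a x := by simp
      change g (qT (ιA (ρ a α - f α • a) x)) = 0
      rw [h', this, map_zero]
    have hwd : ∀ a a' x, q a = q a' → g (qT (ιA a x)) = g (qT (ιA a' x)) := by
      intro a a' x h
      have hm : a - a' ∈ J := (hq_ker _).1 (by rw [map_sub, h, sub_self])
      have := hv x _ hm
      simpa [sub_eq_zero] using this
    have hbd : ∀ a x, ‖g (qT (ιA a x))‖ ≤ ‖q a‖ * ‖x‖ := by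
      intro a x
      rcases (norm_nonneg x).eq_or_lt with hx | hx
      · have : x = 0 := norm_eq_zero.1 hx.symm
        simp [this]
      rw [← div_le_iff₀ hx, hq_norm]
      refine quot_norm_le_of_forall _ _ _ fun j hj => ?_
      rw [div_le_iff₀ hx, hwd a (a + j) x (by rw [map_add, (hq_ker j).2 hj, add_zero])]
      exact (hgle _).trans ((hqT_le _).trans (hTAX.1 _ _))
    let s : B → A := Function.surjInv hq_surj
    have hs : ∀ b, q (s b) = b := Function.surjInv_eq hq_surj
    let φ : B →ₗ[ℂ] X →ₗ[ℂ] ℂ := LinearMap.mk₂ ℂ (fun b x => g (qT (ιA (s b) x)))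
      (fun b b' x => by
        rw [hwd (s (b + b')) (s b + s b') x (by simp [hs])]; simp)
      (fun c b x => by
        rw [hwd (s (c • b)) (c • s b) x (by simp [hs])]; simp)
      (fun b x x' => by simp)
      (fun c b x => by simp)
    obtain ⟨ψ, h1, h2⟩ := hTBX.exists_scalar φ (by
      intro b x
      have := hbd (s b) x
      rwa [hs] at this)
    have h1' : ∀ a x, ψ (ιB (q a) x) = g (qT (ιA a x)) := fun a x =>
      (h1 (q a) x).trans (hwd _ _ x (hs _))
    have heq : ∀ z, ψ (P2 z) = g (P1 z) := by
      intro z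
      induction z using TensorProduct.induction_on with
      | zero => simp
      | tmul a x => rw [hP1, hPA, hP2, h1']
      | add z w hz hw => simp only [map_add, hz, hw]
    have hn : ‖P1 z‖ = ‖ψ (P2 z)‖ := by
      rw [heq, hg2]; simp
    rw [hn]
    exact h2 _
  have hnorm : ∀ z, ‖P2 (LinearEquiv.refl ℂ (TensorProduct ℂ A X) z)‖ = ‖P1 z‖ :=
    fun z => le_antisymm (hle1 z) (hle2 z)
  refine ⟨(LinearEquiv.refl ℂ (TensorProduct ℂ A X)).extendOfIsometry P1 P2 d1 d2 hnorm, ?_⟩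
  intro a x
  have := LinearEquiv.extendOfIsometry_eq (LinearEquiv.refl ℂ (TensorProduct ℂ A X))
    P1 P2 d1 d2 hnorm (a ⊗ₜ[ℂ] x)
  rw [hP1, hPA] at this
  exact this.trans (hP2 a x)
end
end

section
/- Assume J = J₀. Then the closed subspace I₀ of 𝒜 ⊗̂ X equals J ⊗̂ X, i.e., the closed linear span in 𝒜 ⊗̂ X of the elements a·α ⊗ x − a ⊗ α·x (a ∈ 𝒜, α ∈ 𝔄, x ∈ X) coincides with the closure of J ⊗ X in 𝒜 ⊗̂ X. -/
noncomputable section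

universe u

/-- In the standing setting, assume `J = J₀` and that `X` (a commutative
Banach `A`-`𝔄`-bimodule with trivial left `𝔄`-action via `f`, so `α·x = f α • x`) is an
`𝓛₁`-space.  Then the closed subspace `I₀` of `A ⊗̂ X` — the closed linear span of the
elements `a·α ⊗ x − a ⊗ α·x` — coincides with the closure of `J ⊗ X` in `A ⊗̂ X`. -/
theorem stmt_5
    {𝔄 A B X : Type*}
    [NonUnitalNormedRing 𝔄] [NormedSpace ℂ 𝔄] [IsScalarTower ℂ 𝔄 𝔄] [SMulCommClass ℂ 𝔄 𝔄]
    [CompleteSpace 𝔄]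
    [NonUnitalNormedRing A] [NormedSpace ℂ A] [IsScalarTower ℂ A A] [SMulCommClass ℂ A A]
    [CompleteSpace A]
    [NormedRing B] [NormedAlgebra ℂ B] [CompleteSpace B]
    [NormedAddCommGroup X] [NormedSpace ℂ X] [CompleteSpace X]
    -- the character `f` of `𝔄`
    (f : 𝔄 →L[ℂ] ℂ) (hf_mul : ∀ α β, f (α * β) = f α * f β) (hf_ne : f ≠ 0)
    -- the right action of `𝔄` on `A` (the left action is the trivial one `α · a = f α • a`)
    (ρ : A →L[ℂ] 𝔄 →L[ℂ] A)
    (hρ_act : ∀ a α β, ρ (ρ a α) β = ρ a (α * β))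
    (hρ_mul : ∀ a b α, ρ (a * b) α = a * ρ b α)
    -- `J` is the closed ideal generated by the elements `(a·α)b − a(α·b)`
    (J : Submodule ℂ A)
    (hJ : IsClosedIdealGeneratedBy J {x | ∃ (a b : A) (α : 𝔄), x = ρ a α * b - f α • (a * b)})
    -- the assumption `J = J₀`
    (hJ0 : J = (Submodule.span ℂ {x : A | ∃ (a : A) (α : 𝔄), x = ρ a α - f α • a}).topologicalClosure)
    -- the quotient map `q : A → B = A/J`, `B` unital
    (q : A →L[ℂ] B) (hq_mul : ∀ a b, q (a * b) = q a * q b)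
    (hq_surj : Function.Surjective q)
    (hq_ker : ∀ a, q a = 0 ↔ a ∈ J)
    (hq_norm : ∀ a, ‖q a‖ = ⨅ j : J, ‖a + (j : A)‖)
    -- `X` is a commutative Banach `A`-`𝔄`-bimodule with trivial left `𝔄`-action via `f`,
    -- and an `𝓛₁`-space
    (lX : A →L[ℂ] X →L[ℂ] X) (rX : X →L[ℂ] A →L[ℂ] X)
    (hlX : ∀ a b x, lX (a * b) x = lX a (lX b x))
    (hrX : ∀ x a b, rX (rX x a) b = rX x (a * b))
    (hlrX : ∀ a x b, rX (lX a x) b = lX a (rX x b))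
    (σX : X →L[ℂ] 𝔄 →L[ℂ] X)
    (hσX : ∀ x α, σX x α = f α • x)
    (hcompL : ∀ a α x, f α • lX a x = lX (ρ a α) x)
    (hcompR : ∀ x a α, f α • rX x a = rX x (ρ a α))
    (hX1 : IsL1Space X)
    -- `TAX = A ⊗̂ X`
    {TAX : Type*} [NormedAddCommGroup TAX] [NormedSpace ℂ TAX] [CompleteSpace TAX]
    (ιA : A →L[ℂ] X →L[ℂ] TAX) (hTAX : IsProjectiveTensorProduct.{u} A X TAX ιA)
    :
    -- conclusion: `I₀` equals the closure of `J ⊗ X` in `A ⊗̂ X`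
    (Submodule.span ℂ
        {t : TAX | ∃ (a : A) (α : 𝔄) (x : X), t = ιA (ρ a α) x - f α • ιA a x}).topologicalClosure
      = (Submodule.span ℂ {t : TAX | ∃ j ∈ J, ∃ x : X, t = ιA j x}).topologicalClosure := by
  apply le_antisymm
  · apply Submodule.topologicalClosure_mono
    apply Submodule.span_mono
    rintro t ⟨a, α, x, rfl⟩
    refine ⟨ρ a α - f α • a, ?_, x, ?_⟩
    · rw [hJ0]
      exact Submodule.le_topologicalClosure _ (Submodule.subset_span ⟨a, α, rfl⟩)
    · simp
  · apply Submodule.topologicalClosure_minimal _ _ (Submodule.isClosed_topologicalClosure _)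
    rw [Submodule.span_le]
    rintro t ⟨j, hj, x, rfl⟩
    have hcl : IsClosed (((Submodule.span ℂ {t : TAX | ∃ (a : A) (α : 𝔄) (x : X),
        t = ιA (ρ a α) x - f α • ιA a x}).topologicalClosure.comap
          ((ιA.flip x : A →L[ℂ] TAX) : A →ₗ[ℂ] TAX) : Submodule ℂ A) : Set A) :=
      (Submodule.isClosed_topologicalClosure _).preimage (ιA.flip x).continuous
    rw [hJ0] at hj
    refine Submodule.topologicalClosure_minimal _ ?_ hcl hj
    rw [Submodule.span_le]
    rintro y ⟨a, α, rfl⟩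
    refine Submodule.le_topologicalClosure _ (Submodule.subset_span ⟨a, α, x, ?_⟩)
    simp
end
end

section
/- Assume J = J₀, X is an 𝓛₁-space, and 𝒜/J is an 𝓛₁-space. Then for every k ∈ ℕ, the k-fold module projective tensor product 𝒜 ⊗̂_𝔄 𝒜 ⊗̂_𝔄 ⋯ ⊗̂_𝔄 𝒜 ⊗̂_𝔄 X (with k factors of 𝒜) is isometrically isomorphic to (𝒜/J) ⊗̂ (𝒜/J) ⊗̂ ⋯ ⊗̂ (𝒜/J) ⊗̂ X (with k factors of 𝒜/J). -/
noncomputable section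

universe u

/-- `(T, ι)` is (a realization of) the `k`-fold projective tensor product
`E ⊗̂ ⋯ ⊗̂ E ⊗̂ F` (with `k` factors of `E`): `ι` is a contractive `(k+1)`-linear map
(`k`-linear in `E`, linear in `F`) with dense span of its range, and every bounded
`(k+1)`-linear map linearizes with equal norm. -/
def IsIteratedProjectiveTensorProduct (k : ℕ) (E F T : Type*)
    [NormedAddCommGroup E] [NormedSpace ℂ E] [NormedAddCommGroup F] [NormedSpace ℂ F]
    [NormedAddCommGroup T] [NormedSpace ℂ T] [CompleteSpace T]
    (ι : ContinuousMultilinearMap ℂ (fun _ : Fin k => E) (F →L[ℂ] T)) : Prop :=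
  (∀ (v : Fin k → E) (x : F), ‖ι v x‖ ≤ (∏ i, ‖v i‖) * ‖x‖) ∧
  Dense ((Submodule.span ℂ {t : T | ∃ v x, t = ι v x} : Submodule ℂ T) : Set T) ∧
  ∀ (Y : Type u) [NormedAddCommGroup Y] [NormedSpace ℂ Y] [CompleteSpace Y]
    (φ : ContinuousMultilinearMap ℂ (fun _ : Fin k => E) (F →L[ℂ] Y)),
    ∃ ψ : T →L[ℂ] Y, (∀ v x, ψ (ι v x) = φ v x) ∧ ‖ψ‖ = ‖φ‖

/-- Universal property for scalar-valued contractive forms. -/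
theorem exists_form_linearization {k : ℕ} {E F T : Type*}
    [NormedAddCommGroup E] [NormedSpace ℂ E] [NormedAddCommGroup F] [NormedSpace ℂ F]
    [NormedAddCommGroup T] [NormedSpace ℂ T] [CompleteSpace T]
    (ι : ContinuousMultilinearMap ℂ (fun _ : Fin k => E) (F →L[ℂ] T))
    (h : IsIteratedProjectiveTensorProduct.{u} k E F T ι)
    (φ : ContinuousMultilinearMap ℂ (fun _ : Fin k => E) (F →L[ℂ] ℂ))
    (hφ : ∀ v, ‖φ v‖ ≤ ∏ i, ‖v i‖) :
    ∃ ψ : T →L[ℂ] ℂ, (∀ v x, ψ (ι v x) = φ v x) ∧ ∀ t, ‖ψ t‖ ≤ ‖t‖ := by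
  let U : ℂ ≃L[ℂ] ULift.{u} ℂ := ContinuousLinearEquiv.ulift.symm
  have hU : ∀ z, ‖U z‖ = ‖z‖ := fun z => rfl
  let φ' : ContinuousMultilinearMap ℂ (fun _ : Fin k => E) (F →L[ℂ] ULift.{u} ℂ) :=
    (ContinuousLinearMap.compL ℂ F ℂ (ULift.{u} ℂ) (U : ℂ →L[ℂ] ULift.{u} ℂ)).compContinuousMultilinearMap φ
  have hφ'a : ∀ v x, φ' v x = U (φ v x) := fun v x => rfl
  have : CompleteSpace (ULift.{u} ℂ) := FiniteDimensional.complete ℂ _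
  have hn : ‖φ'‖ ≤ 1 := by
    refine ContinuousMultilinearMap.opNorm_le_bound zero_le_one fun v => ?_
    rw [one_mul]
    refine ContinuousLinearMap.opNorm_le_bound _ (by positivity) fun x => ?_
    rw [hφ'a, hU]
    exact (φ v).le_of_opNorm_le (hφ v) x
  obtain ⟨ψ, h1, h2⟩ := h.2.2 (ULift.{u} ℂ) φ'
  refine ⟨(U.symm : ULift.{u} ℂ →L[ℂ] ℂ).comp ψ, fun v x => ?_, fun t => ?_⟩
  · simp [h1, hφ'a]
  · have : ‖((U.symm : ULift.{u} ℂ →L[ℂ] ℂ).comp ψ) t‖ = ‖ψ t‖ := rfl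
    rw [this]
    simpa using ψ.le_of_opNorm_le (h2.le.trans hn) t

/-- A contractive multilinear map killing the kernel of a quotient map factors contractively. -/
theorem exists_factor_quotient {k : ℕ} {E F G : Type*}
    [NormedAddCommGroup E] [NormedSpace ℂ E] [NormedAddCommGroup F] [NormedSpace ℂ F]
    [NormedAddCommGroup G] [NormedSpace ℂ G]
    (q : E →L[ℂ] F) (hq : ∀ b, ∀ ε > 0, ∃ a, q a = b ∧ ‖a‖ < ‖b‖ + ε)
    (φ : ContinuousMultilinearMap ℂ (fun _ : Fin k => E) G)
    (hφ : ∀ v, ‖φ v‖ ≤ ∏ i, ‖v i‖)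
    (h0 : ∀ v i j, q j = 0 → φ (Function.update v i j) = 0) :
    ∃ φB : ContinuousMultilinearMap ℂ (fun _ : Fin k => F) G,
      (∀ v, φB (fun i => q (v i)) = φ v) ∧ ∀ w, ‖φB w‖ ≤ ∏ i, ‖w i‖ := by
  have hwd : ∀ v v' : Fin k → E, (∀ i, q (v i) = q (v' i)) → φ v = φ v' := by
    intro v v' hv
    have key : ∀ s : Finset (Fin k), φ (s.piecewise v' v) = φ v := by
      intro s
      induction s using Finset.induction_on with
      | empty => simp
      | insert j s hj ih =>
        rw [Finset.piecewise_insert, ← ih]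
        have e1 : v' j = (v' j - v j) + v j := by abel
        rw [e1, φ.map_update_add, h0 _ _ _ (by simp [hv]), zero_add]
        congr 1
        have : v j = s.piecewise v' v j := by simp [hj]
        rw [this, Function.update_eq_self]
    have := key Finset.univ
    simpa using this.symm
  have hs : ∀ b, ∃ a, q a = b := fun b => by
    obtain ⟨a, ha, -⟩ := hq b 1 one_pos
    exact ⟨a, ha⟩
  choose s hs using hs
  let φM : MultilinearMap ℂ (fun _ : Fin k => F) G :=
    { toFun := fun w => φ (fun i => s (w i))
      map_update_add' := by
        intro inst w i x y
        have H : ∀ z z', q z' = z → φ (fun l => s (Function.update w i z l)) =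
            φ (Function.update (fun l => s (w l)) i z') := by
          intro z z' hz
          apply hwd
          intro l
          by_cases hl : l = i
          · subst hl; simp [hs, hz]
          · simp [hl]
        rw [H (x + y) (s x + s y) (by simp [hs]), H x (s x) (hs x), H y (s y) (hs y),
          φ.map_update_add]
      map_update_smul' := by
        intro inst w i c x
        have H : ∀ z z', q z' = z → φ (fun l => s (Function.update w i z l)) =
            φ (Function.update (fun l => s (w l)) i z') := by
          intro z z' hz
          apply hwd
          intro l
          by_cases hl : l = i
          · subst hl; simp [hs, hz]
          · simp [hl]
        rw [H (c • x) (c • s x) (by simp [hs]), H x (s x) (hs x), φ.map_update_smul] }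
  have hM : ∀ w, ‖φM w‖ ≤ ∏ i, ‖w i‖ := by
    intro w
    have hε : ∀ ε > 0, ‖φM w‖ ≤ ∏ i, (‖w i‖ + ε) := by
      intro ε hε
      choose v hv hvn using fun i => hq (w i) ε hε
      have : φM w = φ v := hwd _ _ fun i => by simp [hs, hv]
      rw [this]
      exact (hφ v).trans (Finset.prod_le_prod (fun i _ => norm_nonneg _) fun i _ => (hvn i).le)
    have hc : Continuous fun ε : ℝ => ∏ i, (‖w i‖ + ε) := by fun_prop
    have ht : Filter.Tendsto (fun ε : ℝ => ∏ i, (‖w i‖ + ε)) (nhdsWithin 0 (Set.Ioi 0))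
        (nhds (∏ i, ‖w i‖)) := by
      have := hc.tendsto 0
      simp only [add_zero] at this
      exact this.mono_left nhdsWithin_le_nhds
    refine ge_of_tendsto ht ?_
    filter_upwards [self_mem_nhdsWithin] with ε h using hε ε h
  refine ⟨φM.mkContinuous 1 (by simpa using hM), fun v => ?_, fun w => hM w⟩
  exact hwd _ _ fun i => by simp [hs]

/-- In the standing setting, assume `J = J₀`, `X` is an `𝓛₁`-space and
`A/J` is an `𝓛₁`-space.  Then for every `k ∈ ℕ` (`k = m + 1 ≥ 1`), the `k`-fold module
projective tensor product `A ⊗̂_𝔄 ⋯ ⊗̂_𝔄 A ⊗̂_𝔄 X` (with `k` factors of `A`), i.e. the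
quotient of `A ⊗̂ ⋯ ⊗̂ A ⊗̂ X` by the closed span of the module relations, is isometrically
isomorphic to `(A/J) ⊗̂ ⋯ ⊗̂ (A/J) ⊗̂ X` (with `k` factors of `A/J`). -/
theorem stmt_6
    {𝔄 A B X : Type*}
    [NonUnitalNormedRing 𝔄] [NormedSpace ℂ 𝔄] [IsScalarTower ℂ 𝔄 𝔄] [SMulCommClass ℂ 𝔄 𝔄]
    [CompleteSpace 𝔄]
    [NonUnitalNormedRing A] [NormedSpace ℂ A] [IsScalarTower ℂ A A] [SMulCommClass ℂ A A]
    [CompleteSpace A]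
    [NormedRing B] [NormedAlgebra ℂ B] [CompleteSpace B]
    [NormedAddCommGroup X] [NormedSpace ℂ X] [CompleteSpace X]
    (f : 𝔄 →L[ℂ] ℂ) (hf_mul : ∀ α β, f (α * β) = f α * f β) (hf_ne : f ≠ 0)
    (ρ : A →L[ℂ] 𝔄 →L[ℂ] A)
    (hρ_act : ∀ a α β, ρ (ρ a α) β = ρ a (α * β))
    (hρ_mul : ∀ a b α, ρ (a * b) α = a * ρ b α)
    (J : Submodule ℂ A)
    (hJ : IsClosedIdealGeneratedBy J {x | ∃ (a b : A) (α : 𝔄), x = ρ a α * b - f α • (a * b)})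
    (hJ0 : J = (Submodule.span ℂ {x : A | ∃ (a : A) (α : 𝔄), x = ρ a α - f α • a}).topologicalClosure)
    (q : A →L[ℂ] B) (hq_mul : ∀ a b, q (a * b) = q a * q b)
    (hq_surj : Function.Surjective q)
    (hq_ker : ∀ a, q a = 0 ↔ a ∈ J)
    (hq_norm : ∀ a, ‖q a‖ = ⨅ j : J, ‖a + (j : A)‖)
    -- `X`, a commutative Banach `A`-`𝔄`-bimodule with trivial left `𝔄`-action via `f`
    (lX : A →L[ℂ] X →L[ℂ] X) (rX : X →L[ℂ] A →L[ℂ] X)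
    (hlX : ∀ a b x, lX (a * b) x = lX a (lX b x))
    (hrX : ∀ x a b, rX (rX x a) b = rX x (a * b))
    (hlrX : ∀ a x b, rX (lX a x) b = lX a (rX x b))
    (σX : X →L[ℂ] 𝔄 →L[ℂ] X)
    (hσX : ∀ x α, σX x α = f α • x)
    (hcompL : ∀ a α x, f α • lX a x = lX (ρ a α) x)
    (hcompR : ∀ x a α, f α • rX x a = rX x (ρ a α))
    -- `X` and `A/J` are `𝓛₁`-spaces
    (hX1 : IsL1Space X) (hB1 : IsL1Space B)
    -- the number of factors `k = m + 1 ∈ ℕ`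
    (m : ℕ)
    -- `TA = A ⊗̂ ⋯ ⊗̂ A ⊗̂ X` (`m+1` factors of `A`)
    {TA : Type*} [NormedAddCommGroup TA] [NormedSpace ℂ TA] [CompleteSpace TA]
    (ιA : ContinuousMultilinearMap ℂ (fun _ : Fin (m + 1) => A) (X →L[ℂ] TA))
    (hTA : IsIteratedProjectiveTensorProduct.{u} (m + 1) A X TA ιA)
    -- `TB = (A/J) ⊗̂ ⋯ ⊗̂ (A/J) ⊗̂ X` (`m+1` factors of `A/J`)
    {TB : Type*} [NormedAddCommGroup TB] [NormedSpace ℂ TB] [CompleteSpace TB]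
    (ιB : ContinuousMultilinearMap ℂ (fun _ : Fin (m + 1) => B) (X →L[ℂ] TB))
    (hTB : IsIteratedProjectiveTensorProduct.{u} (m + 1) B X TB ιB)
    -- `Imod`: the closed span of the module relations
    -- `a₁ ⊗ ⋯ ⊗ (aᵢ·α) ⊗ aᵢ₊₁ ⊗ ⋯ ⊗ x − a₁ ⊗ ⋯ ⊗ aᵢ ⊗ (α·aᵢ₊₁) ⊗ ⋯ ⊗ x`
    -- (where the last relation is against `x`, and left actions are trivial via `f`)
    (Imod : Submodule ℂ TA)
    (hImod : Imod = (Submodule.span ℂ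
      {t : TA | ∃ (v : Fin (m + 1) → A) (x : X) (α : 𝔄) (i : Fin (m + 1)),
        t = ιA (Function.update v i (ρ (v i) α)) x - f α • ιA v x}).topologicalClosure)
    -- the quotient `Q = TA / Imod` (the `k`-fold module projective tensor product)
    {Q : Type*} [NormedAddCommGroup Q] [NormedSpace ℂ Q] [CompleteSpace Q]
    (qT : TA →L[ℂ] Q) (hqT_surj : Function.Surjective qT)
    (hqT_ker : ∀ t, qT t = 0 ↔ t ∈ Imod)
    (hqT_norm : ∀ t, ‖qT t‖ = ⨅ s : Imod, ‖t + (s : TA)‖) :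
    -- conclusion: the `k`-fold module projective tensor product is isometrically
    -- isomorphic to `(A/J) ⊗̂ ⋯ ⊗̂ (A/J) ⊗̂ X`
    ∃ e : Q ≃ₗᵢ[ℂ] TB,
      ∀ (v : Fin (m + 1) → A) (x : X), e (qT (ιA v x)) = ιB (fun i => q (v i)) x := by
  have hqle : ∀ a, ‖q a‖ ≤ ‖a‖ := fun a => by
    rw [hq_norm]
    exact (ciInf_le ⟨0, by rintro _ ⟨j, rfl⟩; exact norm_nonneg _⟩ (0 : J)).trans (by simp)
  have hqTle : ∀ a, ‖qT a‖ ≤ ‖a‖ := fun a => by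
    rw [hqT_norm]
    exact (ciInf_le ⟨0, by rintro _ ⟨j, rfl⟩; exact norm_nonneg _⟩ (0 : Imod)).trans (by simp)
  have hqlift : ∀ b, ∀ ε > 0, ∃ a, q a = b ∧ ‖a‖ < ‖b‖ + ε := by
    intro b ε hε
    obtain ⟨a, rfl⟩ := hq_surj b
    have : ⨅ j : J, ‖a + (j : A)‖ < ‖q a‖ + ε := by rw [← hq_norm]; linarith
    obtain ⟨j, hj⟩ := exists_lt_of_ciInf_lt this
    exact ⟨a + j, by rw [map_add, (hq_ker j).2 j.2, add_zero], hj⟩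
  have hqρ : ∀ a α, q (ρ a α) = f α • q a := by
    intro a α
    have : q (ρ a α - f α • a) = 0 := by
      rw [hq_ker, hJ0]
      exact Submodule.le_topologicalClosure _ (Submodule.subset_span ⟨a, α, rfl⟩)
    rwa [map_sub, map_smul, sub_eq_zero] at this
  let aA : (((Fin (m + 1) → A) × X) →₀ ℂ) →ₗ[ℂ] TA := Finsupp.linearCombination ℂ (fun p => ιA p.1 p.2)
  let a : (((Fin (m + 1) → A) × X) →₀ ℂ) →ₗ[ℂ] Q := qT.toLinearMap ∘ₗ aA
  let b : (((Fin (m + 1) → A) × X) →₀ ℂ) →ₗ[ℂ] TB := Finsupp.linearCombination ℂ (fun p => ιB (fun i => q (p.1 i)) p.2)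
  have hdA : DenseRange aA := by
    have h := hTA.2.1
    have : Set.range aA = ((Submodule.span ℂ {t : TA | ∃ v x, t = ιA v x} : Submodule ℂ TA) : Set TA) := by
      rw [← LinearMap.coe_range, Finsupp.range_linearCombination]
      congr 2
      ext t
      simp [eq_comm]
    rw [DenseRange, this]
    exact h
  have hda : DenseRange a := hqT_surj.denseRange.comp hdA qT.continuous
  have hdb : DenseRange b := by
    have h := hTB.2.1
    have : Set.range b = ((Submodule.span ℂ {t : TB | ∃ v x, t = ιB v x} : Submodule ℂ TB) : Set TB) := by
      rw [← LinearMap.coe_range, Finsupp.range_linearCombination]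
      congr 2
      ext t
      constructor
      · rintro ⟨p, rfl⟩
        exact ⟨_, _, rfl⟩
      · rintro ⟨v, x, rfl⟩
        choose w hw using fun i => hq_surj (v i)
        exact ⟨(w, x), by simp [hw]⟩
    rw [DenseRange, this]
    exact h
  have h1 : ∀ p, ‖b p‖ ≤ ‖a p‖ := by
    intro p
    obtain ⟨g, hg, hgp⟩ := exists_dual_vector'' ℂ (b p)
    let φ : ContinuousMultilinearMap ℂ (fun _ : Fin (m + 1) => A) (X →L[ℂ] ℂ) :=
      (ContinuousLinearMap.compL ℂ X TB ℂ g).compContinuousMultilinearMap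
        (ιB.compContinuousLinearMap fun _ => q)
    have hφa : ∀ v x, φ v x = g (ιB (fun i => q (v i)) x) := fun v x => rfl
    obtain ⟨ψ, hψ, hψn⟩ := exists_form_linearization ιA hTA φ (by
      intro v
      refine ContinuousLinearMap.opNorm_le_bound _ (by positivity) fun x => ?_
      rw [hφa]
      have e1 : ‖g (ιB (fun i => q (v i)) x)‖ ≤ ‖ιB (fun i => q (v i)) x‖ := by
        simpa using g.le_of_opNorm_le hg (ιB (fun i => q (v i)) x)
      refine (e1.trans (hTB.1 _ _)).trans ?_
      gcongr with i
      exact hqle _)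
    have hker : ∀ s ∈ Imod, ψ s = 0 := by
      have : Imod ≤ LinearMap.ker ψ.toLinearMap := by
        rw [hImod]
        refine Submodule.topologicalClosure_minimal _ ?_ ψ.isClosed_ker
        rw [Submodule.span_le]
        rintro _ ⟨v, x, α, i, rfl⟩
        have e2 : (fun l => q (Function.update v i (ρ (v i) α) l)) =
            Function.update (fun l => q (v l)) i (f α • q (v i)) := by
          ext l
          by_cases hl : l = i
          · subst hl; simp [hqρ]
          · simp [hl]
        have e3 : Function.update (fun l => q (v l)) i (q (v i)) = fun l => q (v l) :=
          Function.update_eq_self i (fun l => q (v l))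
        simp [hψ, hφa, e2, ιB.map_update_smul]
      exact fun s hs => this hs
    have hψp : ψ (aA p) = g (b p) := by
      simp [aA, b, Finsupp.linearCombination_apply, Finsupp.sum, hψ, hφa]
    have : ‖a p‖ = ⨅ s : Imod, ‖aA p + (s : TA)‖ := hqT_norm _
    rw [this]
    refine le_ciInf fun s => ?_
    refine le_trans (le_of_eq ?_) (hψn _)
    rw [map_add, hker s s.2, add_zero, hψp, hgp]
    simp
  have h2 : ∀ p, ‖a p‖ ≤ ‖b p‖ := by
    intro p
    obtain ⟨g, hg, hgp⟩ := exists_dual_vector'' ℂ (a p)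
    let φ : ContinuousMultilinearMap ℂ (fun _ : Fin (m + 1) => A) (X →L[ℂ] ℂ) :=
      (ContinuousLinearMap.compL ℂ X TA ℂ (g.comp qT)).compContinuousMultilinearMap ιA
    have hφa : ∀ v x, φ v x = g (qT (ιA v x)) := fun v x => rfl
    obtain ⟨φB, hφB, hφBn⟩ := exists_factor_quotient q hqlift φ (by
      intro v
      refine ContinuousLinearMap.opNorm_le_bound _ (by positivity) fun x => ?_
      rw [hφa]
      have e1 : ‖g (qT (ιA v x))‖ ≤ ‖qT (ιA v x)‖ := by
        simpa using g.le_of_opNorm_le hg (qT (ιA v x))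
      exact (e1.trans (hqTle _)).trans (hTA.1 _ _)) (by
      intro v i j hj
      have hle : J ≤ LinearMap.ker (φ.toContinuousLinearMap v i).toLinearMap := by
        rw [hJ0]
        refine Submodule.topologicalClosure_minimal _ ?_ (φ.toContinuousLinearMap v i).isClosed_ker
        rw [Submodule.span_le]
        rintro _ ⟨c, α, rfl⟩
        have e4 : φ (Function.update v i (ρ c α)) = f α • φ (Function.update v i c) := by
          ext x
          have : qT (ιA (Function.update (Function.update v i c) i
              (ρ (Function.update v i c i) α)) x - f α • ιA (Function.update v i c) x) = 0 := by
            rw [hqT_ker, hImod]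
            exact Submodule.le_topologicalClosure _ (Submodule.subset_span ⟨_, x, α, i, rfl⟩)
          rw [map_sub, map_smul, sub_eq_zero] at this
          simp only [Function.update_idem, Function.update_self] at this
          simp [hφa, this]
        have e5 : ∀ c, φ.toContinuousLinearMap v i c = φ (Function.update v i c) := fun c => rfl
        simp [e5, e4, φ.map_update_sub, φ.map_update_smul]
      exact hle ((hq_ker j).1 hj))
    obtain ⟨ψ, hψ, hψn⟩ := exists_form_linearization ιB hTB φB hφBn
    have hψp : ψ (b p) = g (a p) := by
      simp [aA, a, b, Finsupp.linearCombination_apply, Finsupp.sum, hψ, hφB, hφa]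
    have := hψn (b p)
    rw [hψp, hgp] at this
    simpa using this
  refine ⟨(LinearEquiv.refl ℂ (((Fin (m + 1) → A) × X) →₀ ℂ)).extendOfIsometry a b hda hdb
    (fun p => le_antisymm (h1 p) (h2 p)), fun v x => ?_⟩
  have := (LinearEquiv.refl ℂ (((Fin (m + 1) → A) × X) →₀ ℂ)).extendOfIsometry_eq (e₁ := a) (e₂ := b) hda hdb
    (fun p => le_antisymm (h1 p) (h2 p)) (Finsupp.single (v, x) 1)
  simpa [a, aA, b] using this
end
end

section
/- The closed ideal J of ℓ¹(S) generated by the elements δ_{set} − δ_{st} (s, t ∈ S, e ∈ E) equals the closed linear span of the elements δ_s ∗ δ_e − δ_s (s ∈ S, e ∈ E); equivalently, J coincides with J₀, the closed linear span of the elements a·δ_e − f(δ_e)a where f is the augmentation character on ℓ¹(E). -/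
noncomputable section

/-- `S` is an inverse semigroup with inversion `star`: each element `s` has `star s` as its
unique generalized inverse. -/
def IsInverseSemigroup (S : Type*) [Semigroup S] (star : S → S) : Prop :=
  (∀ s, s * star s * s = s) ∧ (∀ s, star s * s * star s = star s) ∧
    ∀ s t, s * t * s = s → t * s * t = t → t = star s

/-- `(L, δ)` is (a realization of) the semigroup Banach algebra `ℓ¹(S)` of a discrete
semigroup `S`: `δ` is the family of point masses, which is multiplicative, the norm of a
finitely supported combination is its `ℓ¹`-norm, and the span of the point masses is
dense. -/
def IsL1SemigroupAlgebra (S : Type*) [Semigroup S] (L : Type*)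
    [NonUnitalNormedRing L] [NormedSpace ℂ L] [CompleteSpace L] (δ : S → L) : Prop :=
  (∀ s t, δ s * δ t = δ (s * t)) ∧
  (∀ (F : Finset S) (c : S → ℂ), ‖∑ s ∈ F, c s • δ s‖ = ∑ s ∈ F, ‖c s‖) ∧
  Function.Injective δ ∧
  Dense ((Submodule.span ℂ (Set.range δ) : Submodule ℂ L) : Set L)

theorem inv_idem_comm {S : Type*} [Semigroup S] (star : S → S) (hS : IsInverseSemigroup S star)
    (e g : S) (he : e * e = e) (hg : g * g = g) : e * g = g * e := by
  obtain ⟨h1, h2, h3⟩ := hS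
  -- products of idempotents are idempotent
  have key : ∀ e g : S, e * e = e → g * g = g → (e * g) * (e * g) = e * g := by
    intro e g he hg
    have he' : ∀ z, e * (e * z) = e * z := fun z => by rw [← mul_assoc, he]
    have hg' : ∀ z, g * (g * z) = g * z := fun z => by rw [← mul_assoc, hg]
    set x := star (e * g) with hx
    have a1 : e * (g * (x * (e * g))) = e * g := by
      have := h1 (e * g); simpa only [mul_assoc] using this
    have a2 : x * (e * (g * x)) = x := by
      have := h2 (e * g); simpa only [mul_assoc] using this
    have a2' : ∀ z, x * (e * (g * (x * z))) = x * z := fun z => by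
      conv_rhs => rw [← a2]
      simp only [mul_assoc]
    have b : g * (x * e) = x := by
      apply h3 (e * g)
      · simp only [mul_assoc, he', hg', a1]
      · simp only [mul_assoc, he', hg', a2']
    have xx : x * x = x := by
      have : (g * (x * e)) * (g * (x * e)) = g * (x * e) := by
        simp only [mul_assoc, a2']
      rwa [b] at this
    have c1 : x = star x := h3 x x (by rw [xx, xx]) (by rw [xx, xx])
    have c2 : e * g = star x := by
      apply h3 x
      · simpa only [mul_assoc] using a2
      · simpa only [mul_assoc] using a1
    rw [c2, ← c1, xx]
  have k1 := key e g he hg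
  have k2 := key g e hg he
  have he' : ∀ z, e * (e * z) = e * z := fun z => by rw [← mul_assoc, he]
  have hg' : ∀ z, g * (g * z) = g * z := fun z => by rw [← mul_assoc, hg]
  have d1 : e * g = star (e * g) := h3 _ _ (by rw [k1, k1]) (by rw [k1, k1])
  have d2 : g * e = star (e * g) := by
    apply h3
    · simpa only [mul_assoc, he', hg'] using k1
    · simpa only [mul_assoc, he', hg'] using k2
  rw [d1, ← d2]

/-- Let `S` be a discrete inverse semigroup with set of idempotents `E`,
let `ℓ¹(E)` act on `ℓ¹(S)` by multiplication from the right and trivially from the left via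
the augmentation character `f`.  The closed ideal `J` of `ℓ¹(S)` generated by the elements
`δ_{set} − δ_{st}` (`s, t ∈ S`, `e ∈ E`) equals the closed linear span of the elements
`δ_s ∗ δ_e − δ_s` (`s ∈ S`, `e ∈ E`); equivalently, `J` coincides with `J₀`, the closed
linear span of the elements `a·δ_e − f(δ_e)a` (indeed of the elements `a·β − f(β)a`,
`a ∈ ℓ¹(S)`, `β ∈ ℓ¹(E)`). -/
theorem stmt_10
    {S : Type*} [Semigroup S] (star : S → S) (hS : IsInverseSemigroup S star)
    -- `L = ℓ¹(S)`
    {L : Type*} [NonUnitalNormedRing L] [NormedSpace ℂ L] [IsScalarTower ℂ L L]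
    [SMulCommClass ℂ L L] [CompleteSpace L]
    (δ : S → L) (hL : IsL1SemigroupAlgebra S L δ)
    -- `LE = ℓ¹(E)`, realized inside `L` via the isometric embedding `κ`
    {LE : Type*} [NonUnitalNormedRing LE] [NormedSpace ℂ LE] [IsScalarTower ℂ LE LE]
    [SMulCommClass ℂ LE LE] [CompleteSpace LE]
    (δE : {e : S // e * e = e} → LE)
    (hδE_norm : ∀ (F : Finset {e : S // e * e = e}) (c : {e : S // e * e = e} → ℂ),
      ‖∑ e ∈ F, c e • δE e‖ = ∑ e ∈ F, ‖c e‖)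
    (hδE_dense : Dense ((Submodule.span ℂ (Set.range δE) : Submodule ℂ LE) : Set LE))
    (κ : LE →L[ℂ] L) (hκ_mul : ∀ x y, κ (x * y) = κ x * κ y) (hκ_iso : ∀ x, ‖κ x‖ = ‖x‖)
    (hκδ : ∀ e, κ (δE e) = δ e.1)
    -- the augmentation character `f` on `ℓ¹(E)`
    (f : LE →L[ℂ] ℂ) (hf_mul : ∀ x y, f (x * y) = f x * f y) (hf_one : ∀ e, f (δE e) = 1)
    -- `J`: the closed ideal of `ℓ¹(S)` generated by the elements `δ_{set} − δ_{st}`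
    (J : Submodule ℂ L)
    (hJ : IsClosedIdealGeneratedBy J
      {x : L | ∃ s t e : S, e * e = e ∧ x = δ (s * e * t) - δ (s * t)}) :
    -- conclusion
    J = (Submodule.span ℂ
        {x : L | ∃ s e : S, e * e = e ∧ x = δ (s * e) - δ s}).topologicalClosure ∧
    J = (Submodule.span ℂ
        {x : L | ∃ (a : L) (β : LE), x = a * κ β - f β • a}).topologicalClosure := by
  have hcomm := inv_idem_comm star hS
  obtain ⟨h1, h2, h3⟩ := hS
  obtain ⟨hmul, -, -, hdense⟩ := hL
  obtain ⟨⟨hJc, hJl, hJr⟩, hJg, hJmin⟩ := hJ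
  set J1 := (Submodule.span ℂ
        {x : L | ∃ s e : S, e * e = e ∧ x = δ (s * e) - δ s}).topologicalClosure with hJ1
  have J1c : IsClosed (J1 : Set L) := Submodule.isClosed_topologicalClosure _
  have J1g : ∀ s e : S, e * e = e → δ (s * e) - δ s ∈ J1 := fun s e he =>
    Submodule.le_topologicalClosure _ (Submodule.subset_span ⟨s, e, he, rfl⟩)
  -- the generators of `J` lie in `J1`
  have gen : ∀ s t e : S, e * e = e → δ (s * e * t) - δ (s * t) ∈ J1 := by
    intro s t e he
    have tt : (t * star t) * (t * star t) = t * star t := by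
      rw [← mul_assoc, h1]
    have c := hcomm e (t * star t) he tt
    have eq : t * (star t * (e * t)) = e * t := by
      calc t * (star t * (e * t)) = ((t * star t) * e) * t := by simp only [mul_assoc]
        _ = (e * (t * star t)) * t := by rw [c]
        _ = e * (t * star t * t) := by simp only [mul_assoc]
        _ = e * t := by rw [h1]
    have idem : (star t * (e * t)) * (star t * (e * t)) = star t * (e * t) := by
      calc (star t * (e * t)) * (star t * (e * t))
          = star t * (e * (t * (star t * (e * t)))) := by simp only [mul_assoc]
        _ = star t * ((e * e) * t) := by rw [eq, mul_assoc]
        _ = star t * (e * t) := by rw [he]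
    have := J1g (s * t) _ idem
    rwa [mul_assoc, eq, ← mul_assoc] at this
  -- induction principle: linear maps sending generators into a closed subspace
  have ind : ∀ (T : L →L[ℂ] L), (∀ s e : S, e * e = e → T (δ (s * e) - δ s) ∈ J1) →
      ∀ x ∈ J1, T x ∈ J1 := by
    intro T hT x hx
    have : J1 ≤ J1.comap (T : L →ₗ[ℂ] L) := by
      apply Submodule.topologicalClosure_minimal
      · rw [Submodule.span_le]
        rintro _ ⟨s, e, he, rfl⟩
        exact hT s e he
      · exact J1c.preimage T.continuous
    exact this hx
  have dind : ∀ (T : L →L[ℂ] L), (∀ s : S, T (δ s) ∈ J1) → ∀ x, T x ∈ J1 := by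
    intro T hT x
    have hle : Submodule.span ℂ (Set.range δ) ≤ J1.comap (T : L →ₗ[ℂ] L) := by
      rw [Submodule.span_le]
      rintro _ ⟨s, rfl⟩
      exact hT s
    exact closure_minimal (t := T ⁻¹' (J1 : Set L)) hle (J1c.preimage T.continuous) (hdense x)
  have J1ideal : IsClosedIdeal J1 := by
    refine ⟨J1c, ?_, ?_⟩
    · intro a x hx
      refine dind ((ContinuousLinearMap.mul ℂ L).flip x) (fun t => ?_) a
      refine ind (ContinuousLinearMap.mul ℂ L (δ t)) (fun s e he => ?_) x hx
      have := J1g (t * s) e he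
      simpa [mul_sub, hmul, mul_assoc] using this
    · intro x a hx
      refine dind (ContinuousLinearMap.mul ℂ L x) (fun t => ?_) a
      refine ind ((ContinuousLinearMap.mul ℂ L).flip (δ t)) (fun s e he => ?_) x hx
      have := gen s t e he
      simpa [sub_mul, hmul] using this
  have main : J = J1 := by
    apply le_antisymm
    · apply hJmin J1 J1ideal
      rintro _ ⟨s, t, e, he, rfl⟩
      exact gen s t e he
    · apply Submodule.topologicalClosure_minimal _ _ hJc
      rw [Submodule.span_le]
      rintro _ ⟨s, e, he, rfl⟩
      apply hJg
      refine ⟨s, star s * s, e, he, ?_⟩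
      have ss : (star s * s) * (star s * s) = star s * s := by
        rw [← mul_assoc, h2]
      have c := hcomm e (star s * s) he ss
      have e1 : s * (star s * s) = s := by rw [← mul_assoc, h1]
      have e2 : s * e * (star s * s) = s * e := by
        rw [mul_assoc, c, ← mul_assoc, e1]
      rw [e1, e2]
  refine ⟨main, ?_⟩
  rw [main]
  apply le_antisymm
  · apply Submodule.topologicalClosure_mono
    apply Submodule.span_mono
    rintro _ ⟨s, e, he, rfl⟩
    refine ⟨δ s, δE ⟨e, he⟩, ?_⟩
    rw [hκδ, hf_one, hmul, one_smul]
  · apply Submodule.topologicalClosure_minimal _ _ J1c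
    rw [Submodule.span_le]
    rintro _ ⟨a, β, rfl⟩
    refine dind ((ContinuousLinearMap.mul ℂ L).flip (κ β) - f β • ContinuousLinearMap.id ℂ L)
      (fun s => ?_) a
    let T : LE →L[ℂ] L := (ContinuousLinearMap.mul ℂ L (δ s)).comp κ - f.smulRight (δ s)
    have hle : Submodule.span ℂ (Set.range δE) ≤ J1.comap (T : LE →ₗ[ℂ] L) := by
      rw [Submodule.span_le]
      rintro _ ⟨e, rfl⟩
      have := J1g s e.1 e.2
      simpa [T, hκδ, hf_one, hmul] using this
    have := closure_minimal (t := T ⁻¹' (J1 : Set L)) hle (J1c.preimage T.continuous)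
      (hδE_dense β)
    simpa [T] using this
end
end

section
/- For every n ∈ ℕ ∪ {0}, the first module cohomology group H¹_{ℓ¹(E)}(ℓ¹(S), ℓ¹(G_S)^{(2n+1)}) vanishes; that is, every ℓ¹(E)-module derivation from ℓ¹(S) into the (2n+1)-th dual of ℓ¹(G_S) is inner. -/
noncomputable section

/-- A Banach space bundled with its structure. -/
structure BanachPkg where
  carrier : Type
  [grp : NormedAddCommGroup carrier]
  [mod : NormedSpace ℂ carrier]
  [cpl : CompleteSpace carrier]

attribute [instance] BanachPkg.grp BanachPkg.mod BanachPkg.cpl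


section OrderedCones

variable {V : Type*} [NormedAddCommGroup V] [NormedSpace ℂ V]

/-- Real elements with respect to a cone: differences of cone elements. -/
def ConeReal (C : Set V) (x : V) : Prop := ∃ a ∈ C, ∃ b ∈ C, x = a - b

/-- A cone giving (the complexification of) a Dedekind complete normed vector lattice. -/
structure OCone (C : Set V) : Prop where
  zero : (0 : V) ∈ C
  add : ∀ a ∈ C, ∀ b ∈ C, a + b ∈ C
  smul : ∀ t : ℝ, 0 ≤ t → ∀ c ∈ C, (t : ℂ) • c ∈ C
  gen : ∃ K : ℝ, 0 ≤ K ∧ ∀ w : V, ∃ a ∈ C, ∃ b ∈ C, ∃ c ∈ C, ∃ d ∈ C,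
    w = a - b + Complex.I • (c - d) ∧ ‖a‖ ≤ K * ‖w‖ ∧ ‖b‖ ≤ K * ‖w‖ ∧ ‖c‖ ≤ K * ‖w‖ ∧
      ‖d‖ ≤ K * ‖w‖
  indep : ∀ a ∈ C, ∀ b ∈ C, ∀ c ∈ C, ∀ d ∈ C, a - b + Complex.I • (c - d) = 0 → a = b ∧ c = d
  normal : ∃ K : ℝ, 0 ≤ K ∧ ∀ a ∈ C, ∀ b ∈ C, ‖a‖ ≤ K * ‖a + b‖
  sup : ∀ Φ : Set V, Φ.Nonempty → (∀ x ∈ Φ, ConeReal C x) → ∀ u, (∀ x ∈ Φ, u - x ∈ C) →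
    ∃ p, ConeReal C p ∧ (∀ x ∈ Φ, p - x ∈ C) ∧ ∀ q, (∀ x ∈ Φ, q - x ∈ C) → q - p ∈ C

/-- Order unit. -/
def OUnit (C : Set V) : Prop :=
  ∃ u ∈ C, ∀ r, ConeReal C r → ((‖r‖ : ℝ) : ℂ) • u - r ∈ C

/-- A functional dominating the norm on the cone. -/
def LFun (C : Set V) : Prop :=
  ∃ e : V →L[ℂ] ℂ, ∀ c ∈ C, ‖c‖ ≤ (e c).re ∧ (e c).im = 0

theorem OCone.antisymm {C : Set V} (h : OCone C) {a : V} (ha : a ∈ C) (hb : -a ∈ C) : a = 0 := by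
  obtain ⟨K, hK, hn⟩ := h.normal
  have := hn a ha (-a) hb
  simpa using this

theorem OCone.refine_sum {C : Set V} (h : OCone C) {x y c d : V} (hx : x ∈ C) (hy : y ∈ C)
    (hc : c ∈ C) (hd : d ∈ C) (e : x + y = c + d) :
    ∃ a₁ ∈ C, ∃ a₂ ∈ C, ∃ b₁ ∈ C, ∃ b₂ ∈ C, x = a₁ + a₂ ∧ y = b₁ + b₂ ∧ c = a₁ + b₁ ∧
      d = a₂ + b₂ := by
  have e2 : y - (c - x) = d := by
    have : y = c + d - x := by rw [← e]; abel
    rw [this]; abel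
  obtain ⟨p, -, hp1, hp2⟩ := h.sup {c - x, 0} (by simp)
    (by
      rintro z (rfl | rfl)
      · exact ⟨c, hc, x, hx, rfl⟩
      · exact ⟨0, h.zero, 0, h.zero, by simp⟩) y
    (by
      rintro z (rfl | rfl)
      · rw [e2]; exact hd
      · simpa using hy)
  have p0 : p ∈ C := by simpa using hp1 0 (by simp)
  have px : p - (c - x) ∈ C := hp1 _ (by simp)
  have yp : y - p ∈ C := hp2 y (by
      rintro z (rfl | rfl)
      · rw [e2]; exact hd
      · simpa using hy)
  have cp : c - p ∈ C := hp2 c (by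
      rintro z (rfl | rfl)
      · simpa using hx
      · simpa using hc)
  refine ⟨c - p, cp, p - (c - x), px, p, p0, y - p, yp, by abel, by abel, by abel, ?_⟩
  rw [← e2]; abel

/-- Extension of additive functions on the cone. -/
theorem OCone.extend {C : Set V} (h : OCone C) : ∃ K : ℝ, 0 ≤ K ∧ ∀ (p : V → ℝ) (B : ℝ), 0 ≤ B →
    (∀ a ∈ C, ∀ b ∈ C, p (a + b) = p a + p b) →
    (∀ t : ℝ, 0 ≤ t → ∀ a ∈ C, p ((t : ℂ) • a) = t * p a) →
    (∀ a ∈ C, |p a| ≤ B * ‖a‖) →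
    ∃ φ : V →L[ℂ] ℂ, (∀ c ∈ C, φ c = (p c : ℂ)) ∧ ‖φ‖ ≤ K * B := by
  obtain ⟨K, hK, hg⟩ := h.gen
  refine ⟨4 * K, by positivity, fun p B hB hadd hsm hb => ?_⟩
  choose a ha b hb' c hc d hd hw na nb nc nd using hg
  let F : V → ℂ := fun w => (p (a w) : ℂ) - p (b w) + Complex.I * (p (c w) - p (d w))
  have key : ∀ w, ∀ a' ∈ C, ∀ b' ∈ C, ∀ c' ∈ C, ∀ d' ∈ C, w = a' - b' + Complex.I • (c' - d') →
      F w = (p a' : ℂ) - p b' + Complex.I * (p c' - p d') := by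
    intro w a' ha' b' hb'' c' hc' d' hd' e
    have := h.indep (a w + b') (h.add _ (ha w) _ hb'') (a' + b w) (h.add _ ha' _ (hb' w))
      (c w + d') (h.add _ (hc w) _ hd') (c' + d w) (h.add _ hc' _ (hd w)) (by
        have e2 := (hw w).symm.trans e
        rw [← sub_eq_zero] at e2
        rw [← e2]; module)
    obtain ⟨h1, h2⟩ := this
    have h1' := congrArg p h1
    have h2' := congrArg p h2
    rw [hadd _ (ha w) _ hb'', hadd _ ha' _ (hb' w)] at h1'
    rw [hadd _ (hc w) _ hd', hadd _ hc' _ (hd w)] at h2'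
    have h1c : (p (a w) : ℂ) + p b' = p a' + p (b w) := by exact_mod_cast h1'
    have h2c : (p (c w) : ℂ) + p d' = p c' + p (d w) := by exact_mod_cast h2'
    simp only [F]
    linear_combination h1c + Complex.I * h2c
  let L : V →ₗ[ℂ] ℂ :=
    { toFun := F
      map_add' := by
        intro v w
        rw [key (v + w) _ (h.add _ (ha v) _ (ha w)) _ (h.add _ (hb' v) _ (hb' w))
          _ (h.add _ (hc v) _ (hc w)) _ (h.add _ (hd v) _ (hd w))
          (by conv_lhs => rw [hw v, hw w]
              module)]
        rw [hadd _ (ha v) _ (ha w), hadd _ (hb' v) _ (hb' w), hadd _ (hc v) _ (hc w),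
          hadd _ (hd v) _ (hd w)]
        simp only [F]; push_cast; ring
      map_smul' := by
        intro z w
        obtain ⟨x1, x2, hx1, hx2, hx⟩ : ∃ x1 x2 : ℝ, 0 ≤ x1 ∧ 0 ≤ x2 ∧ z.re = x1 - x2 :=
          ⟨max z.re 0, max (-z.re) 0, le_max_right _ _, le_max_right _ _, by
            rcases le_total z.re 0 with h0 | h0
            · rw [max_eq_right h0, max_eq_left (by linarith)]; ring
            · rw [max_eq_left h0, max_eq_right (by linarith)]; ring⟩
        obtain ⟨y1, y2, hy1, hy2, hy⟩ : ∃ x1 x2 : ℝ, 0 ≤ x1 ∧ 0 ≤ x2 ∧ z.im = x1 - x2 :=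
          ⟨max z.im 0, max (-z.im) 0, le_max_right _ _, le_max_right _ _, by
            rcases le_total z.im 0 with h0 | h0
            · rw [max_eq_right h0, max_eq_left (by linarith)]; ring
            · rw [max_eq_left h0, max_eq_right (by linarith)]; ring⟩
        have hz : z = ((x1 : ℂ) - x2) + (y1 - y2) * Complex.I := by
          rw [← Complex.re_add_im z, hx, hy]; push_cast; ring
        have four : ∀ s1 s2 s3 s4 : ℝ, 0 ≤ s1 → 0 ≤ s2 → 0 ≤ s3 → 0 ≤ s4 →
            ∀ v1 ∈ C, ∀ v2 ∈ C, ∀ v3 ∈ C, ∀ v4 ∈ C,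
            ((s1 : ℂ) • v1 + (s2 : ℂ) • v2 + ((s3 : ℂ) • v3 + (s4 : ℂ) • v4)) ∈ C ∧
            p ((s1 : ℂ) • v1 + (s2 : ℂ) • v2 + ((s3 : ℂ) • v3 + (s4 : ℂ) • v4)) =
              s1 * p v1 + s2 * p v2 + (s3 * p v3 + s4 * p v4) := by
          intro s1 s2 s3 s4 h1 h2 h3 h4 v1 k1 v2 k2 v3 k3 v4 k4
          have m1 := h.smul s1 h1 v1 k1
          have m2 := h.smul s2 h2 v2 k2
          have m3 := h.smul s3 h3 v3 k3
          have m4 := h.smul s4 h4 v4 k4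
          refine ⟨h.add _ (h.add _ m1 _ m2) _ (h.add _ m3 _ m4), ?_⟩
          rw [hadd _ (h.add _ m1 _ m2) _ (h.add _ m3 _ m4), hadd _ m1 _ m2, hadd _ m3 _ m4,
            hsm _ h1 _ k1, hsm _ h2 _ k2, hsm _ h3 _ k3, hsm _ h4 _ k4]
        obtain ⟨q1, r1⟩ := four x1 x2 y1 y2 hx1 hx2 hy1 hy2 _ (ha w) _ (hb' w) _ (hd w) _ (hc w)
        obtain ⟨q2, r2⟩ := four x1 x2 y1 y2 hx1 hx2 hy1 hy2 _ (hb' w) _ (ha w) _ (hc w) _ (hd w)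
        obtain ⟨q3, r3⟩ := four x1 x2 y1 y2 hx1 hx2 hy1 hy2 _ (hc w) _ (hd w) _ (ha w) _ (hb' w)
        obtain ⟨q4, r4⟩ := four x1 x2 y1 y2 hx1 hx2 hy1 hy2 _ (hd w) _ (hc w) _ (hb' w) _ (ha w)
        rw [key (z • w) _ q1 _ q2 _ q3 _ q4 (by
          conv_lhs => rw [hw w, hz]
          have hI : Complex.I * Complex.I = -1 := Complex.I_mul_I
          match_scalars <;> first
            | ring1
            | linear_combination (y1 - y2 : ℂ) * hI
            | linear_combination (y2 - y1 : ℂ) * hI)]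
        rw [r1, r2, r3, r4]
        simp only [F, RingHom.id_apply, smul_eq_mul]
        rw [hz]; push_cast
        have hI : Complex.I * Complex.I = -1 := Complex.I_mul_I
        linear_combination (-(y1 - y2 : ℂ) * (p (c w) - p (d w))) * hI }
  have bd : ∀ w, ‖L w‖ ≤ 4 * K * B * ‖w‖ := by
    intro w
    have e1 : ∀ v ∈ C, ‖v‖ ≤ K * ‖w‖ → ‖(p v : ℂ)‖ ≤ B * (K * ‖w‖) := by
      intro v hv hn
      rw [Complex.norm_real]
      exact (hb v hv).trans (mul_le_mul_of_nonneg_left hn hB)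
    have := e1 _ (ha w) (na w)
    have := e1 _ (hb' w) (nb w)
    have := e1 _ (hc w) (nc w)
    have := e1 _ (hd w) (nd w)
    calc ‖L w‖ ≤ ‖(p (a w) : ℂ) - p (b w)‖ + ‖Complex.I * ((p (c w) : ℂ) - p (d w))‖ :=
          norm_add_le _ _
      _ ≤ (‖(p (a w) : ℂ)‖ + ‖(p (b w) : ℂ)‖) + (‖(p (c w) : ℂ)‖ + ‖(p (d w) : ℂ)‖) := by
          rw [norm_mul, Complex.norm_I, one_mul]
          exact add_le_add (norm_sub_le _ _) (norm_sub_le _ _)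
      _ ≤ _ := by linarith
  refine ⟨L.mkContinuous _ bd, ?_, L.mkContinuous_norm_le (by positivity) bd⟩
  intro v hv
  have p0 : p 0 = 0 := by
    have := hadd 0 h.zero 0 h.zero
    simp at this; exact this
  have := key v v hv 0 h.zero 0 h.zero 0 h.zero (by simp)
  change F v = _
  rw [this, p0]; simp

/-- The set of values of finite decompositions. -/
inductive TVal (C : Set V) (Φ : Set (V →L[ℂ] ℂ)) : V → ℝ → Prop
  | base (φ : V →L[ℂ] ℂ) (hφ : φ ∈ Φ) (c : V) (hc : c ∈ C) : TVal C Φ c (φ c).re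
  | step (c d : V) (r s : ℝ) (h1 : TVal C Φ c r) (h2 : TVal C Φ d s) : TVal C Φ (c + d) (r + s)

theorem TVal.mem {C : Set V} (h : OCone C) {Φ : Set (V →L[ℂ] ℂ)} {c : V} {r : ℝ}
    (ht : TVal C Φ c r) : c ∈ C := by
  induction ht with
  | base φ hφ c hc => exact hc
  | step c d r s h1 h2 i1 i2 => exact h.add _ i1 _ i2

theorem TVal.smul {C : Set V} (h : OCone C) {Φ : Set (V →L[ℂ] ℂ)} {c : V} {r : ℝ}
    (ht : TVal C Φ c r) (t : ℝ) (h0 : 0 ≤ t) : TVal C Φ ((t : ℂ) • c) (t * r) := by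
  induction ht with
  | base φ hφ c hc =>
    have := TVal.base (C := C) φ hφ _ (h.smul t h0 c hc)
    simpa using this
  | step c d r s h1 h2 i1 i2 =>
    rw [smul_add, mul_add]; exact TVal.step _ _ _ _ i1 i2

theorem TVal.split {C : Set V} (h : OCone C) {Φ : Set (V →L[ℂ] ℂ)} {x : V} {r : ℝ}
    (ht : TVal C Φ x r) : ∀ c ∈ C, ∀ d ∈ C, x = c + d →
    ∃ r₁ r₂, TVal C Φ c r₁ ∧ TVal C Φ d r₂ ∧ r = r₁ + r₂ := by
  induction ht with
  | base φ hφ x hx =>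
    rintro c hc d hd rfl
    exact ⟨_, _, TVal.base φ hφ c hc, TVal.base φ hφ d hd, by simp⟩
  | step x y r s h1 h2 i1 i2 =>
    intro c hc d hd e
    obtain ⟨a₁, ha₁, a₂, ha₂, b₁, hb₁, b₂, hb₂, e1, e2, e3, e4⟩ :=
      h.refine_sum (h1.mem h) (h2.mem h) hc hd e
    obtain ⟨p1, p2, t1, t2, rfl⟩ := i1 _ ha₁ _ ha₂ e1
    obtain ⟨q1, q2, u1, u2, rfl⟩ := i2 _ hb₁ _ hb₂ e2
    refine ⟨p1 + q1, p2 + q2, ?_, ?_, by ring⟩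
    · rw [e3]; exact TVal.step _ _ _ _ t1 u1
    · rw [e4]; exact TVal.step _ _ _ _ t2 u2

theorem OCone.dualSup {C : Set V} (h : OCone C) : ∃ K : ℝ, 0 ≤ K ∧
    ∀ (Φ : Set (V →L[ℂ] ℂ)) (B : ℝ), (∀ c r, TVal C Φ c r → r ≤ B * ‖c‖) →
    (∃ φ ∈ Φ, ‖φ‖ ≤ B) →
    ∃ p : V →L[ℂ] ℂ, (∀ c ∈ C, (p c).im = 0) ∧ (∀ c r, TVal C Φ c r → r ≤ (p c).re) ∧
      (∀ c ∈ C, ∀ y, (∀ r, TVal C Φ c r → r ≤ y) → (p c).re ≤ y) ∧ ‖p‖ ≤ K * B := by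
  obtain ⟨K, hK, hext⟩ := h.extend
  refine ⟨K, hK, ?_⟩
  rintro Φ B hB ⟨φ0, hφ0, hn0⟩
  let T : V → Set ℝ := fun c => {r | TVal C Φ c r}
  have hne : ∀ c ∈ C, (T c).Nonempty := fun c hc => ⟨_, TVal.base φ0 hφ0 c hc⟩
  have hbd : ∀ c, BddAbove (T c) := fun c => ⟨_, fun r hr => hB c r hr⟩
  have hadd : ∀ a ∈ C, ∀ b ∈ C, sSup (T (a + b)) = sSup (T a) + sSup (T b) := by
    intro a ha b hb
    apply le_antisymm
    · apply csSup_le (hne _ (h.add _ ha _ hb))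
      intro r hr
      obtain ⟨r1, r2, t1, t2, rfl⟩ := TVal.split h hr a ha b hb rfl
      exact add_le_add (le_csSup (hbd a) t1) (le_csSup (hbd b) t2)
    · have : ∀ r ∈ T a, ∀ s ∈ T b, r + s ≤ sSup (T (a + b)) := fun r hr s hs =>
        le_csSup (hbd _) (TVal.step _ _ _ _ hr hs)
      have h1 : ∀ r ∈ T a, sSup (T b) ≤ sSup (T (a + b)) - r := fun r hr =>
        csSup_le (hne b hb) fun s hs => by linarith [this r hr s hs]
      have h2 : sSup (T a) ≤ sSup (T (a + b)) - sSup (T b) :=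
        csSup_le (hne a ha) fun r hr => by linarith [h1 r hr]
      linarith
  have hle : ∀ t : ℝ, 0 ≤ t → ∀ a ∈ C, t * sSup (T a) ≤ sSup (T ((t : ℂ) • a)) := by
    intro t ht a ha
    rcases ht.eq_or_lt with rfl | ht'
    · have := hadd 0 h.zero 0 h.zero
      simp at this
      simp [this]
    · rw [mul_comm, ← le_div_iff₀ ht']
      apply csSup_le (hne a ha)
      intro r hr
      rw [le_div_iff₀ ht', mul_comm]
      exact le_csSup (hbd _) (TVal.smul h hr t ht)
  obtain ⟨p, hp, hpn⟩ := hext (fun c => sSup (T c)) B ((norm_nonneg _).trans hn0) hadd (by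
      intro t ht a ha
      apply le_antisymm _ (hle t ht a ha)
      rcases ht.eq_or_lt with rfl | ht'
      · have := hadd 0 h.zero 0 h.zero
        simp at this
        simp [this]
      · have := hle t⁻¹ (by positivity) _ (h.smul t ht a ha)
        rw [smul_smul, ← Complex.ofReal_mul, inv_mul_cancel₀ ht'.ne', Complex.ofReal_one,
          one_smul, inv_mul_le_iff₀ ht'] at this
        exact this) (by
      intro a ha
      rw [abs_le]
      constructor
      · have h1 : (φ0 a).re ≤ sSup (T a) := le_csSup (hbd a) (TVal.base φ0 hφ0 a ha)
        have h2 : |(φ0 a).re| ≤ B * ‖a‖ := (Complex.abs_re_le_norm _).trans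
          ((φ0.le_opNorm a).trans (by gcongr))
        linarith [(abs_le.1 h2).1]
      · exact csSup_le (hne a ha) fun r hr => hB a r hr)
  refine ⟨p, ?_, ?_, ?_, hpn⟩
  · intro c hc; rw [hp c hc]; simp
  · intro c r hr
    rw [hp c (hr.mem h), Complex.ofReal_re]
    exact le_csSup (hbd c) hr
  · intro c hc y hy
    rw [hp c hc, Complex.ofReal_re]
    exact csSup_le (hne c hc) hy

/-- Dual cone, transported along an isometry with the dual. -/
def dualCone {V' : Type*} [NormedAddCommGroup V'] [NormedSpace ℂ V']
    (e : V' ≃ₗᵢ[ℂ] (V →L[ℂ] ℂ)) (C : Set V) : Set V' :=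
  {φ | ∀ c ∈ C, 0 ≤ (e φ c).re ∧ (e φ c).im = 0}

theorem OCone.ext_dual {C : Set V} (h : OCone C) {φ ψ : V →L[ℂ] ℂ} (hh : ∀ c ∈ C, φ c = ψ c) :
    φ = ψ := by
  obtain ⟨K, hK, hg⟩ := h.gen
  ext w
  obtain ⟨a, ha, b, hb, c, hc, d, hd, rfl, -⟩ := hg w
  simp [hh a ha, hh b hb, hh c hc, hh d hd]

/-- Decomposition of the real part of a functional. -/
theorem OCone.dualPos {C : Set V} (h : OCone C) : ∃ K : ℝ, 0 ≤ K ∧ ∀ φ : V →L[ℂ] ℂ,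
    ∃ p q : V →L[ℂ] ℂ, (∀ c ∈ C, 0 ≤ (p c).re ∧ (p c).im = 0) ∧
      (∀ c ∈ C, 0 ≤ (q c).re ∧ (q c).im = 0) ∧
      (∀ c ∈ C, (p c - q c) = ((φ c).re : ℂ)) ∧ ‖p‖ ≤ K * ‖φ‖ ∧ ‖q‖ ≤ K * ‖φ‖ := by
  obtain ⟨K1, hK1, hS⟩ := h.dualSup
  obtain ⟨K2, hK2, hext⟩ := h.extend
  obtain ⟨N, hN, hnorm⟩ := h.normal
  refine ⟨K1 * N + K2 * (K1 * N + 1), by positivity, fun φ => ?_⟩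
  have hT : ∀ c r, TVal C {φ, 0} c r → ∃ x ∈ C, c - x ∈ C ∧ r = (φ x).re := by
    intro c r ht
    induction ht with
    | base ψ hψ c hc =>
      rcases hψ with rfl | rfl
      · exact ⟨c, hc, by simpa using h.zero, rfl⟩
      · exact ⟨0, h.zero, by simpa using hc, by simp⟩
    | step c d r s h1 h2 i1 i2 =>
      obtain ⟨x, hx, hx', rfl⟩ := i1
      obtain ⟨y, hy, hy', rfl⟩ := i2
      refine ⟨x + y, h.add _ hx _ hy, ?_, by simp⟩
      have := h.add _ hx' _ hy'
      rwa [add_sub_add_comm]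
  obtain ⟨p, hp1, hp2, hp3, hp4⟩ := hS {φ, 0} (N * ‖φ‖) (by
      intro c r ht
      obtain ⟨x, hx, hx', rfl⟩ := hT c r ht
      have h1 := hnorm x hx _ hx'
      rw [add_sub_cancel] at h1
      calc (φ x).re ≤ ‖φ x‖ := Complex.re_le_norm _
        _ ≤ ‖φ‖ * ‖x‖ := φ.le_opNorm x
        _ ≤ ‖φ‖ * (N * ‖c‖) := by gcongr
        _ = _ := by ring) ⟨0, by simp, by simp; positivity⟩
  have hpφ : ∀ c ∈ C, (φ c).re ≤ (p c).re := fun c hc => hp2 c _ (TVal.base φ (by simp) c hc)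
  have hp0 : ∀ c ∈ C, 0 ≤ (p c).re := fun c hc => by
    simpa using hp2 c _ (TVal.base (0 : V →L[ℂ] ℂ) (by simp) c hc)
  obtain ⟨q, hq, hqn⟩ := hext (fun c => (p c).re - (φ c).re) (K1 * (N * ‖φ‖) + ‖φ‖)
    (by positivity) (by intro a _ b _; simp; ring) (by intro t _ a _; simp; ring) (by
      intro a ha
      have h1 : |(p a).re| ≤ K1 * (N * ‖φ‖) * ‖a‖ := (Complex.abs_re_le_norm _).trans
        ((p.le_opNorm a).trans (by gcongr))
      have h2 : |(φ a).re| ≤ ‖φ‖ * ‖a‖ := (Complex.abs_re_le_norm _).trans (φ.le_opNorm a)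
      calc |(p a).re - (φ a).re| ≤ |(p a).re| + |(φ a).re| := abs_sub _ _
        _ ≤ _ := by linarith)
  refine ⟨p, q, fun c hc => ⟨hp0 c hc, hp1 c hc⟩, fun c hc => ?_, fun c hc => ?_, ?_, ?_⟩
  · rw [hq c hc]; simpa using hpφ c hc
  · rw [hq c hc]; apply Complex.ext <;> simp [hp1 c hc]
  · refine hp4.trans ?_
    have : 0 ≤ K2 * (K1 * N + 1) * ‖φ‖ := by positivity
    nlinarith
  · refine hqn.trans ?_
    have : 0 ≤ K1 * N * ‖φ‖ := by positivity
    nlinarith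

variable {V' : Type*} [NormedAddCommGroup V'] [NormedSpace ℂ V']

theorem OCone.dual_real {C : Set V} {e : V' ≃ₗᵢ[ℂ] (V →L[ℂ] ℂ)} {x : V'}
    (hx : ConeReal (dualCone e C) x) : ∀ c ∈ C, (e x c).im = 0 := by
  obtain ⟨a, ha, b, hb, rfl⟩ := hx
  intro c hc
  simp [(ha c hc).2, (hb c hc).2]

theorem OCone.dual_real_of {C : Set V} (h : OCone C) {e : V' ≃ₗᵢ[ℂ] (V →L[ℂ] ℂ)} {x : V'}
    (hx : ∀ c ∈ C, (e x c).im = 0) : ConeReal (dualCone e C) x := by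
  obtain ⟨K, hK, hd⟩ := h.dualPos
  obtain ⟨p, q, hp, hq, hpq, -⟩ := hd (e x)
  refine ⟨e.symm p, by simpa [dualCone] using hp, e.symm q, by simpa [dualCone] using hq, ?_⟩
  apply e.injective
  rw [map_sub, e.apply_symm_apply, e.apply_symm_apply]
  apply h.ext_dual
  intro c hc
  rw [_root_.sub_apply, hpq c hc]
  apply Complex.ext <;> simp [hx c hc]

theorem OCone.dual {C : Set V} (h : OCone C) (e : V' ≃ₗᵢ[ℂ] (V →L[ℂ] ℂ)) :
    OCone (dualCone e C) where
  zero := by intro c hc; simp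
  add := by
    intro a ha b hb c hc
    have h1 := ha c hc
    have h2 := hb c hc
    simp only [map_add, _root_.add_apply, Complex.add_re, Complex.add_im]
    exact ⟨by linarith, by linarith⟩
  smul := by
    intro t ht a ha c hc
    have h1 := ha c hc
    simp only [map_smul, _root_.smul_apply, smul_eq_mul, Complex.re_ofReal_mul,
      Complex.im_ofReal_mul, h1.2, mul_zero, and_true]
    exact mul_nonneg ht h1.1
  gen := by
    obtain ⟨K, hK, hd⟩ := h.dualPos
    refine ⟨K, hK, fun w => ?_⟩
    obtain ⟨a, b, ha, hb, hab, na, nb⟩ := hd (e w)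
    obtain ⟨c, d, hc, hd, hcd, nc, nd⟩ := hd (-(Complex.I • e w))
    rw [norm_neg, norm_smul, Complex.norm_I, one_mul] at nc nd
    rw [e.norm_map] at na nb nc nd
    refine ⟨e.symm a, by simpa [dualCone] using ha, e.symm b, by simpa [dualCone] using hb,
      e.symm c, by simpa [dualCone] using hc, e.symm d, by simpa [dualCone] using hd, ?_,
      by simpa using na, by simpa using nb, by simpa using nc, by simpa using nd⟩
    apply e.injective
    simp only [map_add, map_sub, map_smul, e.apply_symm_apply]
    apply h.ext_dual
    intro x hx
    simp only [_root_.add_apply, _root_.sub_apply,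
      _root_.smul_apply, hab x hx, hcd x hx]
    apply Complex.ext <;> simp
  indep := by
    intro a ha b hb c hc d hd hh
    have hh' := congrArg e hh
    simp only [map_add, map_sub, map_smul, map_zero] at hh'
    have key : ∀ x ∈ C, e a x = e b x ∧ e c x = e d x := by
      intro x hx
      have h1 := congrArg (fun ψ : V →L[ℂ] ℂ => ψ x) hh'
      simp only [_root_.add_apply, _root_.sub_apply,
        _root_.smul_apply, _root_.zero_apply] at h1
      have h2 := congrArg Complex.re h1
      have h3 := congrArg Complex.im h1
      simp [(ha x hx).2, (hb x hx).2, (hc x hx).2, (hd x hx).2] at h2 h3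
      constructor
      · apply Complex.ext
        · linarith
        · rw [(ha x hx).2, (hb x hx).2]
      · apply Complex.ext
        · linarith
        · rw [(hc x hx).2, (hd x hx).2]
    exact ⟨e.injective (h.ext_dual fun x hx => (key x hx).1),
      e.injective (h.ext_dual fun x hx => (key x hx).2)⟩
  normal := by
    obtain ⟨K, hK, hg⟩ := h.gen
    refine ⟨4 * K, by positivity, fun a ha b hb => ?_⟩
    rw [← e.norm_map a]
    apply ContinuousLinearMap.opNorm_le_bound _ (by positivity)
    intro w
    obtain ⟨x, hx, y, hy, z, hz, t, ht, hw, nx, ny, nz, nt⟩ := hg w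
    have key : ∀ v ∈ C, ‖v‖ ≤ K * ‖w‖ → ‖e a v‖ ≤ ‖a + b‖ * (K * ‖w‖) := by
      intro v hv hn
      have h1 : ‖e a v‖ = (e a v).re := by
        have : e a v = ((e a v).re : ℂ) := by apply Complex.ext <;> simp [(ha v hv).2]
        rw [this, Complex.norm_real, Real.norm_eq_abs, abs_of_nonneg (ha v hv).1]; simp
      have h2 : (e a v).re ≤ (e (a + b) v).re := by
        simpa using (hb v hv).1
      rw [h1]
      refine h2.trans ((Complex.re_le_norm _).trans (((e (a + b)).le_opNorm v).trans ?_))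
      rw [e.norm_map]; gcongr
    have k1 := key x hx nx
    have k2 := key y hy ny
    have k3 := key z hz nz
    have k4 := key t ht nt
    have : e a w = (e a x - e a y) + Complex.I * (e a z - e a t) := by
      conv_lhs => rw [hw]
      simp
    rw [this]
    calc _ ≤ ‖e a x - e a y‖ + ‖Complex.I * (e a z - e a t)‖ := norm_add_le _ _
      _ ≤ (‖e a x‖ + ‖e a y‖) + (‖e a z‖ + ‖e a t‖) := by
          rw [norm_mul, Complex.norm_I, one_mul]
          exact add_le_add (norm_sub_le _ _) (norm_sub_le _ _)
      _ ≤ _ := by linarith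
  sup := by
    rintro Φ ⟨x0, hx0⟩ hΦ u hu
    obtain ⟨K, hK, hS⟩ := h.dualSup
    have hle : ∀ v, (∀ x ∈ Φ, v - x ∈ dualCone e C) → ∀ c r, TVal C (Set.image (fun z => e z) Φ) c r →
        r ≤ (e v c).re := by
      intro v hv c r ht
      induction ht with
      | base φ hφ c hc =>
        obtain ⟨x, hx, rfl⟩ := hφ
        simpa using (hv x hx c hc).1
      | step c d r s h1 h2 i1 i2 => simpa using add_le_add i1 i2
    obtain ⟨p, hp1, hp2, hp3, -⟩ := hS (Set.image (fun z => e z) Φ) (max ‖u‖ ‖x0‖) (by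
        intro c r ht
        refine (hle u hu c r ht).trans ((Complex.re_le_norm _).trans
          (((e u).le_opNorm c).trans ?_))
        rw [e.norm_map]
        gcongr
        exact le_max_left _ _) ⟨e x0, ⟨x0, hx0, rfl⟩, by simp⟩
    refine ⟨e.symm p, h.dual_real_of (by simpa using hp1), ?_, ?_⟩
    · intro x hx c hc
      have := hp2 c _ (TVal.base (C := C) (e x) (Set.mem_image_of_mem (fun z => e z) hx) c hc)
      have h2 := OCone.dual_real (hΦ x hx) c hc
      simp [h2, hp1 c hc, this]
    · intro q hq c hc
      have h1 := hp3 c hc _ (hle q hq c)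
      have h2 := (hq x0 hx0 c hc).2
      have h3 := OCone.dual_real (hΦ x0 hx0) c hc
      simp [h3] at h2
      simp [h1, h2, hp1 c hc]

theorem LFun.dual {C : Set V} (hl : LFun C) (e : V' ≃ₗᵢ[ℂ] (V →L[ℂ] ℂ)) :
    OUnit (dualCone e C) := by
  obtain ⟨f, hf⟩ := hl
  refine ⟨e.symm f, ?_, ?_⟩
  · intro c hc
    have := hf c hc
    simp only [LinearIsometryEquiv.apply_symm_apply]
    exact ⟨(norm_nonneg c).trans this.1, this.2⟩
  · intro r hr c hc
    have h1 := hf c hc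
    have h2 := OCone.dual_real hr c hc
    simp only [map_sub, map_smul, LinearIsometryEquiv.apply_symm_apply,
      _root_.sub_apply, _root_.smul_apply, smul_eq_mul,
      Complex.sub_re, Complex.sub_im, Complex.re_ofReal_mul, Complex.im_ofReal_mul, h1.2, h2]
    refine ⟨?_, by simp⟩
    have h3 : (e r c).re ≤ ‖r‖ * ‖c‖ := (Complex.re_le_norm _).trans
      (((e r).le_opNorm c).trans (by rw [e.norm_map]))
    have h4 : ‖r‖ * ‖c‖ ≤ ‖r‖ * (f c).re := mul_le_mul_of_nonneg_left h1.1 (norm_nonneg _)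
    linarith

theorem OUnit.dual {C : Set V} (h : OCone C) (hl : OUnit C) (e : V' ≃ₗᵢ[ℂ] (V →L[ℂ] ℂ)) :
    LFun (dualCone e C) := by
  obtain ⟨u, hu, hr⟩ := hl
  obtain ⟨K, hK, hg⟩ := h.gen
  refine ⟨((4 * K : ℝ) : ℂ) • ((ContinuousLinearMap.apply ℂ ℂ u).comp
    (e.toContinuousLinearEquiv : V' →L[ℂ] (V →L[ℂ] ℂ))), ?_⟩
  intro a ha
  have hau := ha u hu
  have E : (((4 * K : ℝ) : ℂ) • ((ContinuousLinearMap.apply ℂ ℂ u).comp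
    (e.toContinuousLinearEquiv : V' →L[ℂ] (V →L[ℂ] ℂ)))) a = ((4 * K : ℝ) : ℂ) * e a u := rfl
  rw [E, Complex.re_ofReal_mul, Complex.im_ofReal_mul, hau.2]
  refine ⟨?_, by simp⟩
  rw [← e.norm_map a]
  apply ContinuousLinearMap.opNorm_le_bound _ (mul_nonneg (by positivity) hau.1)
  intro w
  obtain ⟨x, hx, y, hy, z, hz, t, ht, hw, nx, ny, nz, nt⟩ := hg w
  have key : ∀ v ∈ C, ‖v‖ ≤ K * ‖w‖ → ‖e a v‖ ≤ (K * ‖w‖) * (e a u).re := by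
    intro v hv hn
    have h1 : ‖e a v‖ = (e a v).re := by
      have : e a v = ((e a v).re : ℂ) := by apply Complex.ext <;> simp [(ha v hv).2]
      rw [this, Complex.norm_real, Real.norm_eq_abs, abs_of_nonneg (ha v hv).1]; simp
    have h2 := (ha _ (hr v ⟨v, hv, 0, h.zero, by simp⟩)).1
    simp only [map_sub, map_smul, smul_eq_mul, Complex.sub_re, Complex.re_ofReal_mul] at h2
    rw [h1]
    have := mul_le_mul_of_nonneg_right hn hau.1
    linarith
  have k1 := key x hx nx
  have k2 := key y hy ny
  have k3 := key z hz nz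
  have k4 := key t ht nt
  have : e a w = (e a x - e a y) + Complex.I * (e a z - e a t) := by
    conv_lhs => rw [hw]
    simp
  rw [this]
  calc _ ≤ ‖e a x - e a y‖ + ‖Complex.I * (e a z - e a t)‖ := norm_add_le _ _
    _ ≤ (‖e a x‖ + ‖e a y‖) + (‖e a z‖ + ‖e a t‖) := by
        rw [norm_mul, Complex.norm_I, one_mul]
        exact add_le_add (norm_sub_le _ _) (norm_sub_le _ _)
    _ ≤ _ := by linarith

/-- Cone of coordinatewise nonnegative elements in an `ℓ^∞`-like space. -/
theorem OCone.base {G : Type*} [Nonempty G] (ev : G → V →ₗ[ℂ] ℂ)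
    (h1 : ∀ g v, ‖ev g v‖ ≤ ‖v‖)
    (h2 : ∀ v (M : ℝ), 0 ≤ M → (∀ g, ‖ev g v‖ ≤ M) → ‖v‖ ≤ M)
    (h3 : ∀ (u : G → ℂ) (M : ℝ), (∀ g, ‖u g‖ ≤ M) → ∃ v, ∀ g, ev g v = u g) :
    OCone {v | ∀ g, 0 ≤ (ev g v).re ∧ (ev g v).im = 0} ∧
    OUnit {v | ∀ g, 0 ≤ (ev g v).re ∧ (ev g v).im = 0} := by
  have hext : ∀ v w, (∀ g, ev g v = ev g w) → v = w := by
    intro v w hvw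
    rw [← sub_eq_zero, ← norm_le_zero_iff]
    exact h2 _ 0 le_rfl fun g => by simp [hvw g]
  have hreal : ∀ r : V, ConeReal {v | ∀ g, 0 ≤ (ev g v).re ∧ (ev g v).im = 0} r →
      ∀ g, (ev g r).im = 0 := by
    rintro r ⟨a, ha, b, hb, rfl⟩ g
    simp [(ha g).2, (hb g).2]
  have hnn : ∀ v : V, ∀ k : ℂ, ‖k‖ ≤ 1 → ∃ p, (∀ g, ev g p = ((max (k * ev g v).re 0 : ℝ) : ℂ)) ∧
      ‖p‖ ≤ 1 * ‖v‖ := by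
    intro v k hk
    have bd : ∀ g, ‖((max (k * ev g v).re 0 : ℝ) : ℂ)‖ ≤ ‖v‖ := by
      intro g
      rw [Complex.norm_real, Real.norm_eq_abs, abs_of_nonneg (le_max_right _ _)]
      apply max_le _ (norm_nonneg _)
      refine (Complex.re_le_norm _).trans ?_
      rw [norm_mul]
      calc _ ≤ 1 * ‖ev g v‖ := by gcongr
        _ ≤ _ := by rw [one_mul]; exact h1 g v
    obtain ⟨p, hp⟩ := h3 _ _ bd
    refine ⟨p, hp, ?_⟩
    rw [one_mul]
    exact h2 p _ (norm_nonneg _) fun g => by rw [hp g]; exact bd g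
  have max_sub : ∀ x : ℝ, max x 0 - max (-x) 0 = x := by
    intro x
    rcases le_total x 0 with h0 | h0
    · rw [max_eq_right h0, max_eq_left (by linarith)]; ring
    · rw [max_eq_left h0, max_eq_right (by linarith)]; ring
  refine ⟨⟨?_, ?_, ?_, ?_, ?_, ?_, ?_⟩, ?_⟩
  · intro g; simp
  · intro a ha b hb g
    have := ha g
    have := hb g
    simp only [map_add, Complex.add_re, Complex.add_im]
    constructor <;> linarith
  · intro t ht a ha g
    have h1 := ha g
    simp only [map_smul, smul_eq_mul, Complex.re_ofReal_mul, Complex.im_ofReal_mul, h1.2,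
      mul_zero, and_true]
    exact mul_nonneg ht h1.1
  · refine ⟨1, zero_le_one, fun w => ?_⟩
    obtain ⟨a, ha, na⟩ := hnn w 1 (by simp)
    obtain ⟨b, hb, nb⟩ := hnn w (-1) (by simp)
    obtain ⟨c, hc, nc⟩ := hnn w (-Complex.I) (by simp)
    obtain ⟨d, hd, nd⟩ := hnn w (Complex.I) (by simp)
    refine ⟨a, fun g => by simp [ha g], b, fun g => by simp [hb g], c, fun g => by simp [hc g],
      d, fun g => by simp [hd g], ?_, na, nb, nc, nd⟩
    apply hext
    intro g
    have m1 := max_sub (ev g w).re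
    have m2 := max_sub (ev g w).im
    apply Complex.ext
    · simp [ha, hb, hc, hd, m1]
    · simp [ha, hb, hc, hd, m2]
  · intro a ha b hb c hc d hd hh
    have key : ∀ g, ev g a = ev g b ∧ ev g c = ev g d := by
      intro g
      have h1 := congrArg (ev g) hh
      simp only [map_add, map_sub, map_smul, map_zero, smul_eq_mul] at h1
      have h2 := congrArg Complex.re h1
      have h3 := congrArg Complex.im h1
      simp [(ha g).2, (hb g).2, (hc g).2, (hd g).2] at h2 h3
      constructor
      · apply Complex.ext
        · linarith
        · rw [(ha g).2, (hb g).2]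
      · apply Complex.ext
        · linarith
        · rw [(hc g).2, (hd g).2]
    exact ⟨hext _ _ fun g => (key g).1, hext _ _ fun g => (key g).2⟩
  · refine ⟨1, zero_le_one, fun a ha b hb => ?_⟩
    rw [one_mul]
    apply h2 _ _ (norm_nonneg _)
    intro g
    have e1 : ‖ev g a‖ = (ev g a).re := by
      have : ev g a = ((ev g a).re : ℂ) := by apply Complex.ext <;> simp [(ha g).2]
      rw [this, Complex.norm_real, Real.norm_eq_abs, abs_of_nonneg (ha g).1]; simp
    rw [e1]
    refine le_trans ?_ ((Complex.re_le_norm _).trans (h1 g (a + b)))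
    simpa using (hb g).1
  · rintro Φ ⟨x0, hx0⟩ hΦ u hu
    have hup : ∀ q, (∀ x ∈ Φ, q - x ∈ {v | ∀ g, 0 ≤ (ev g v).re ∧ (ev g v).im = 0}) →
        ∀ g, ∀ x ∈ Φ, (ev g x).re ≤ (ev g q).re := by
      intro q hq g x hx
      simpa using (hq x hx g).1
    let s : G → ℝ := fun g => sSup (Set.image (fun x => (ev g x).re) Φ)
    have hbdd : ∀ g, BddAbove (Set.image (fun x => (ev g x).re) Φ) := fun g =>
      ⟨(ev g u).re, by rintro _ ⟨x, hx, rfl⟩; exact hup u hu g x hx⟩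
    have hs1 : ∀ g, ∀ x ∈ Φ, (ev g x).re ≤ s g := fun g x hx => le_csSup (hbdd g) ⟨x, hx, rfl⟩
    have hs2 : ∀ q, (∀ x ∈ Φ, q - x ∈ {v | ∀ g, 0 ≤ (ev g v).re ∧ (ev g v).im = 0}) →
        ∀ g, s g ≤ (ev g q).re := by
      intro q hq g
      apply csSup_le (Set.Nonempty.image _ ⟨x0, hx0⟩)
      rintro _ ⟨x, hx, rfl⟩
      exact hup q hq g x hx
    obtain ⟨p, hp⟩ := h3 (fun g => (s g : ℂ)) (max ‖u‖ ‖x0‖) (by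
      intro g
      rw [Complex.norm_real, Real.norm_eq_abs, abs_le]
      have a1 := hs1 g x0 hx0
      have a2 := (abs_le.1 ((Complex.abs_re_le_norm _).trans (h1 g x0))).1
      have a3 := hs2 u hu g
      have a4 := (Complex.re_le_norm _).trans (h1 g u)
      have a5 := le_max_left ‖u‖ ‖x0‖
      have a6 := le_max_right ‖u‖ ‖x0‖
      constructor <;> linarith)
    have hpC : ∀ x ∈ Φ, p - x ∈ {v | ∀ g, 0 ≤ (ev g v).re ∧ (ev g v).im = 0} := by
      intro x hx g
      simp [hp g, hs1 g x hx, hreal x (hΦ x hx) g]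
    refine ⟨p, ?_, hpC, ?_⟩
    · obtain ⟨a, ha, b, hb, hab⟩ := hΦ x0 hx0
      refine ⟨p - x0 + a, ?_, b, hb, ?_⟩
      · intro g
        have q1 := hpC x0 hx0 g
        have q2 := ha g
        rw [map_add, Complex.add_re, Complex.add_im]
        constructor <;> linarith
      · have : a = x0 + b := by rw [hab]; abel
        rw [this]; abel
    · intro q hq g
      have q1 := (hq x0 hx0 g).2
      rw [map_sub, Complex.sub_im, hreal x0 (hΦ x0 hx0) g] at q1
      simp only [map_sub, Complex.sub_re, Complex.sub_im, hp g, Complex.ofReal_re,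
        Complex.ofReal_im]
      exact ⟨by linarith [hs2 q hq g], by linarith⟩
  · obtain ⟨u, hu⟩ := h3 (fun _ => 1) 1 (by simp)
    refine ⟨u, fun g => by simp [hu g], ?_⟩
    intro r hr g
    have := (Complex.re_le_norm _).trans (h1 g r)
    simp [hu g, hreal r hr g, this]

/-- Bounded cocycles for positive actions are coboundaries. -/
theorem OCone.fixed {C : Set V} (h : OCone C) (hu : OUnit C) {G : Type*} [Group G]
    (A : G → V →ₗ[ℂ] V) (A1 : ∀ v, A 1 v = v) (Amul : ∀ g k v, A (g * k) v = A g (A k v))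
    (Apos : ∀ g, ∀ c ∈ C, A g c ∈ C) (φ : G → V) (B : ℝ) (hB : ∀ g, ‖φ g‖ ≤ B)
    (hφ : ∀ g k, φ (g * k) = A g (φ k) + φ g) : ∃ w, ∀ g, φ g = w - A g w := by
  have AR : ∀ g x, ConeReal C x → ConeReal C (A g x) := by
    rintro g x ⟨a, ha, b, hb, rfl⟩
    exact ⟨_, Apos g a ha, _, Apos g b hb, by simp⟩
  have Radd : ∀ x y, ConeReal C x → ConeReal C y → ConeReal C (x + y) := by
    rintro x y ⟨a, ha, b, hb, rfl⟩ ⟨c, hc, d, hd, rfl⟩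
    exact ⟨_, h.add _ ha _ hc, _, h.add _ hb _ hd, by abel⟩
  have Rneg : ∀ x, ConeReal C x → ConeReal C (-x) := by
    rintro x ⟨a, ha, b, hb, rfl⟩
    exact ⟨b, hb, a, ha, by abel⟩
  have Rind : ∀ x y x' y', ConeReal C x → ConeReal C y → ConeReal C x' → ConeReal C y' →
      x + Complex.I • y = x' + Complex.I • y' → x = x' ∧ y = y' := by
    intro x y x' y' hx hy hx' hy' hh
    obtain ⟨a, ha, b, hb, e1⟩ := Radd _ _ hx (Rneg _ hx')
    obtain ⟨c, hc, d, hd, e2⟩ := Radd _ _ hy (Rneg _ hy')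
    have := h.indep a ha b hb c hc d hd (by
      rw [← e1, ← e2]
      rw [← sub_eq_zero] at hh
      rw [← hh]; module)
    rw [this.1, sub_self] at e1
    rw [this.2, sub_self] at e2
    exact ⟨by rwa [← sub_eq_add_neg, sub_eq_zero] at e1, by rwa [← sub_eq_add_neg, sub_eq_zero] at e2⟩
  -- the real case
  have real : ∀ (x : G → V) (M : ℝ), (∀ g, ConeReal C (x g)) → (∀ g, ‖x g‖ ≤ M) →
      (∀ g k, x (g * k) = A g (x k) + x g) → ∃ w, ∀ g, x g = w - A g w := by
    intro x M hx hM hc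
    obtain ⟨u, huC, hu⟩ := hu
    obtain ⟨p, -, hp1, hp2⟩ := h.sup (Set.range x) ⟨_, 1, rfl⟩ (by rintro _ ⟨g, rfl⟩; exact hx g)
      ((M : ℂ) • u) (by
        rintro _ ⟨g, rfl⟩
        have := h.add _ (hu _ (hx g)) _ (h.smul (M - ‖x g‖) (by linarith [hM g]) u huC)
        convert this using 1
        push_cast; module)
    have x1 : x 1 = 0 := by
      have := hc 1 1
      rw [A1, mul_one] at this
      simpa using this
    have hle : ∀ g, A g p + x g - p ∈ C := by
      intro g
      apply hp2
      rintro _ ⟨k, rfl⟩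
      have e1 : x k = A g (x (g⁻¹ * k)) + x g := by rw [← hc, mul_inv_cancel_left]
      have := Apos g _ (hp1 _ ⟨g⁻¹ * k, rfl⟩)
      rw [map_sub] at this
      rw [e1]
      convert this using 1
      abel
    refine ⟨p, fun g => ?_⟩
    have e1 := Apos g _ (hle g⁻¹)
    have e2 : A g (x g⁻¹) = - x g := by
      have := hc g g⁻¹
      rw [mul_inv_cancel, x1] at this
      exact eq_neg_of_add_eq_zero_left this.symm
    rw [map_sub, map_add, ← Amul, mul_inv_cancel, A1, e2] at e1
    have := h.antisymm (hle g) (by convert e1 using 1; abel)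
    have h3 : x g = (A g p + x g - p) + (p - A g p) := by abel
    rw [h3, this, zero_add]
  obtain ⟨K, hK, hg⟩ := h.gen
  choose a ha b hb c hc d hd hw na nb nc nd using fun g => hg (φ g)
  have rx : ∀ g, ConeReal C (a g - b g) := fun g => ⟨_, ha g, _, hb g, rfl⟩
  have ry : ∀ g, ConeReal C (c g - d g) := fun g => ⟨_, hc g, _, hd g, rfl⟩
  have co : ∀ g k, a (g * k) - b (g * k) = A g (a k - b k) + (a g - b g) ∧
      c (g * k) - d (g * k) = A g (c k - d k) + (c g - d g) := by
    intro g k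
    apply Rind _ _ _ _ (rx _) (ry _) (Radd _ _ (AR _ _ (rx k)) (rx g))
      (Radd _ _ (AR _ _ (ry k)) (ry g))
    rw [← hw, hφ]
    conv_lhs => rw [hw k, hw g]
    rw [map_add, map_smul]
    module
  have bound : ∀ g, K * ‖φ g‖ ≤ K * B := fun g => mul_le_mul_of_nonneg_left (hB g) hK
  obtain ⟨w1, hw1⟩ := real (fun g => a g - b g) (K * B + K * B) rx (fun g => (norm_sub_le _ _).trans
    (add_le_add ((na g).trans (bound g)) ((nb g).trans (bound g)))) fun g k => (co g k).1
  obtain ⟨w2, hw2⟩ := real (fun g => c g - d g) (K * B + K * B) ry (fun g => (norm_sub_le _ _).trans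
    (add_le_add ((nc g).trans (bound g)) ((nd g).trans (bound g)))) fun g k => (co g k).2
  refine ⟨w1 + Complex.I • w2, fun g => ?_⟩
  have e1 := hw1 g
  have e2 := hw2 g
  rw [hw g, e1, e2, map_add, map_smul]
  module

end OrderedCones

section L1

variable {X : Type*} [NormedAddCommGroup X] [NormedSpace ℂ X] {G : Type*} (v : G → X)

theorem l1_exists
    (hn : ∀ (F : Finset G) (c : G → ℂ), ‖∑ s ∈ F, c s • v s‖ = ∑ s ∈ F, ‖c s‖)
    (u : G → ℂ) (M : ℝ) (hM0 : 0 ≤ M) (hM : ∀ g, ‖u g‖ ≤ M) :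
    ∃ φ : X →L[ℂ] ℂ, ∀ g, φ (v g) = u g := by
  have li : LinearIndependent ℂ v := by
    rw [linearIndependent_iff']
    intro F c h0 i hi
    have := hn F c
    rw [h0, norm_zero] at this
    have := (Finset.sum_eq_zero_iff_of_nonneg (fun _ _ => norm_nonneg _)).1 this.symm i hi
    simpa using this
  let L0 : Submodule.span ℂ (Set.range v) →ₗ[ℂ] ℂ :=
    (Finsupp.linearCombination ℂ u).comp li.repr
  have bd : ∀ x, ‖L0 x‖ ≤ M * ‖x‖ := by
    intro x
    have h1 : ‖x‖ = ∑ s ∈ (li.repr x).support, ‖li.repr x s‖ := by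
      have h0 := li.linearCombination_repr x
      rw [Finsupp.linearCombination_apply, Finsupp.sum] at h0
      rw [← hn, h0]
      rfl
    have h2 : L0 x = ∑ s ∈ (li.repr x).support, li.repr x s * u s := by
      simp [L0, Finsupp.linearCombination_apply, Finsupp.sum]
    rw [h1, h2, Finset.mul_sum]
    refine (norm_sum_le _ _).trans (Finset.sum_le_sum fun s _ => ?_)
    rw [norm_mul, mul_comm]
    exact mul_le_mul_of_nonneg_right (hM s) (norm_nonneg _)
  obtain ⟨φ, hφ, -⟩ := exists_extension_norm_eq _ (L0.mkContinuous M bd)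
  refine ⟨φ, fun g => ?_⟩
  have := hφ ⟨v g, Submodule.subset_span ⟨g, rfl⟩⟩
  rw [this]
  change L0 _ = _
  simp only [L0, LinearMap.comp_apply]
  rw [li.repr_eq_single g _ rfl]
  simp

theorem l1_norm
    (hn : ∀ (F : Finset G) (c : G → ℂ), ‖∑ s ∈ F, c s • v s‖ = ∑ s ∈ F, ‖c s‖)
    (hd : Dense ((Submodule.span ℂ (Set.range v) : Submodule ℂ X) : Set X))
    (φ : X →L[ℂ] ℂ) (M : ℝ) (hM : ∀ g, ‖φ (v g)‖ ≤ M) (x : X) : ‖φ x‖ ≤ M * ‖x‖ := by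
  have hcl : IsClosed {x : X | ‖φ x‖ ≤ M * ‖x‖} :=
    isClosed_le (by fun_prop) (by fun_prop)
  have hsub : ((Submodule.span ℂ (Set.range v) : Submodule ℂ X) : Set X) ⊆
      {x : X | ‖φ x‖ ≤ M * ‖x‖} := by
    intro y hy
    obtain ⟨c, rfl⟩ := (Finsupp.mem_span_range_iff_exists_finsupp).1 hy
    simp only [Set.mem_setOf_eq, Finsupp.sum]
    rw [hn, map_sum, Finset.mul_sum]
    refine (norm_sum_le _ _).trans (Finset.sum_le_sum fun s _ => ?_)
    rw [map_smul, norm_smul, mul_comm]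
    exact mul_le_mul_of_nonneg_right (hM s) (norm_nonneg _)
  exact hcl.closure_subset_iff.2 hsub (hd x)

end L1

/-- Let `S` be a discrete inverse semigroup with set of idempotents `E`,
let `ℓ¹(E)` act on `ℓ¹(S)` by multiplication from the right and trivially from the left via
the augmentation character `f`, and let `G_S` be the maximal group homomorphic image of
`S`, so that `ℓ¹(S)/J ≅ ℓ¹(G_S)`.  Let `W m` be the tower of iterated duals of `ℓ¹(G_S)`
(`W 0 = ℓ¹(G_S)` via `ψ0`, `W (m+1) = (W m)*` via the pairings `eD`), with the canonical
dual `ℓ¹(S)`-bimodule actions `lW`, `rW`.  Then for every `n ∈ ℕ ∪ {0}`, the first module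
cohomology group `H¹_{ℓ¹(E)}(ℓ¹(S), ℓ¹(G_S)^{(2n+1)})` vanishes: every `ℓ¹(E)`-module
derivation from `ℓ¹(S)` into the `(2n+1)`-st dual of `ℓ¹(G_S)` is inner. -/
theorem stmt_11

    {S : Type*} [Semigroup S] (star : S → S) (hS : IsInverseSemigroup S star)
    -- `L = ℓ¹(S)`
    {L : Type*} [NonUnitalNormedRing L] [NormedSpace ℂ L] [IsScalarTower ℂ L L]
    [SMulCommClass ℂ L L] [CompleteSpace L]
    (δ : S → L) (hL : IsL1SemigroupAlgebra S L δ)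
    -- `LE = ℓ¹(E)`, realized inside `L` via the isometric embedding `κ`
    {LE : Type*} [NonUnitalNormedRing LE] [NormedSpace ℂ LE] [IsScalarTower ℂ LE LE]
    [SMulCommClass ℂ LE LE] [CompleteSpace LE]
    (δE : {e : S // e * e = e} → LE)
    (hδE_norm : ∀ (F : Finset {e : S // e * e = e}) (c : {e : S // e * e = e} → ℂ),
      ‖∑ e ∈ F, c e • δE e‖ = ∑ e ∈ F, ‖c e‖)
    (hδE_dense : Dense ((Submodule.span ℂ (Set.range δE) : Submodule ℂ LE) : Set LE))
    (κ : LE →L[ℂ] L) (hκ_mul : ∀ x y, κ (x * y) = κ x * κ y) (hκ_iso : ∀ x, ‖κ x‖ = ‖x‖)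
    (hκδ : ∀ e, κ (δE e) = δ e.1)
    -- the augmentation character `f` on `ℓ¹(E)`
    (f : LE →L[ℂ] ℂ) (hf_mul : ∀ x y, f (x * y) = f x * f y) (hf_one : ∀ e, f (δE e) = 1)
    -- `J`: the closed ideal of `ℓ¹(S)` generated by the elements `δ_{set} − δ_{st}`
    (J : Submodule ℂ L)
    (hJ : IsClosedIdealGeneratedBy J
      {x : L | ∃ s t e : S, e * e = e ∧ x = δ (s * e * t) - δ (s * t)})
    -- `G = G_S = S/∼`, the maximal group homomorphic image of `S`
    {G : Type*} [Group G] (π : S → G)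
    (hπ_mul : ∀ s t, π (s * t) = π s * π t) (hπ_surj : Function.Surjective π)
    (hπ_rel : ∀ s t, π s = π t ↔ δ s - δ t ∈ J)
    (hπ_univ : ∀ (H : Type) [Group H] (φ : S → H), (∀ s t, φ (s * t) = φ s * φ t) →
      ∃ ψ : G →* H, ∀ s, ψ (π s) = φ s)
    -- `LG = ℓ¹(G_S)`
    {LG : Type*} [NormedRing LG] [NormedAlgebra ℂ LG] [CompleteSpace LG]
    (δG : G → LG) (hLG : IsL1SemigroupAlgebra G LG δG)
    -- `θ : ℓ¹(S) → ℓ¹(G_S)`: the continuous algebra homomorphism induced by `π`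
    (θ : L →L[ℂ] LG) (hθ_mul : ∀ a b, θ (a * b) = θ a * θ b)
    (hθδ : ∀ s, θ (δ s) = δG (π s))
    (hθ_surj : Function.Surjective θ)
    (hθ_ker : ∀ a, θ a = 0 ↔ a ∈ J)
    (hθ_norm : ∀ a, ‖θ a‖ = ⨅ j : J, ‖a + (j : L)‖)
    -- the tower `W m = ℓ¹(G_S)^{(m)}` of iterated duals of `ℓ¹(G_S)`
    (W : ℕ → BanachPkg)
    (ψ0 : (W 0).carrier ≃ₗᵢ[ℂ] LG)
    (eD : ∀ m, (W (m + 1)).carrier ≃ₗᵢ[ℂ] ((W m).carrier →L[ℂ] ℂ))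
    -- the canonical `ℓ¹(S)`-bimodule actions on the tower: on `W 0 = ℓ¹(G_S)` via the
    -- algebra homomorphism `θ`, and on each dual by transposition
    (lW : ∀ m, L →L[ℂ] (W m).carrier →L[ℂ] (W m).carrier)
    (rW : ∀ m, (W m).carrier →L[ℂ] L →L[ℂ] (W m).carrier)
    (hlW0 : ∀ (a : L) (w : (W 0).carrier), ψ0 (lW 0 a w) = θ a * ψ0 w)
    (hrW0 : ∀ (w : (W 0).carrier) (a : L), ψ0 (rW 0 w a) = ψ0 w * θ a)
    (hlWsucc : ∀ (m : ℕ) (a : L) (φ : (W (m + 1)).carrier) (w : (W m).carrier),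
      eD m (lW (m + 1) a φ) w = eD m φ (rW m w a))
    (hrWsucc : ∀ (m : ℕ) (φ : (W (m + 1)).carrier) (a : L) (w : (W m).carrier),
      eD m (rW (m + 1) φ a) w = eD m φ (lW m a w))
    (n : ℕ) :
    -- conclusion: every `ℓ¹(E)`-module derivation `D : ℓ¹(S) → ℓ¹(G_S)^{(2n+1)}` is inner
    ∀ D : L →L[ℂ] (W (2 * n + 1)).carrier,
      (∀ a b, D (a * b) = lW (2 * n + 1) a (D b) + rW (2 * n + 1) (D a) b) →
      (∀ (a : L) (β : LE), D (a * κ β) = f β • D a) →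
      ∃ w : (W (2 * n + 1)).carrier, ∀ a, D a = lW (2 * n + 1) a w - rW (2 * n + 1) w a := by
  intro D hD hDE
  obtain ⟨hLm, hLn, -, hLd⟩ := hL
  obtain ⟨hGm, hGn, -, hGd⟩ := hLG
  obtain ⟨hS1, hS2, -⟩ := hS
  -- basic facts on `π`
  have hπe : ∀ e, e * e = e → π e = 1 := by
    intro e he
    have := hπ_mul e e
    rw [he] at this
    exact (left_eq_mul.1 this)
  have hstar : ∀ s, π (star s) = (π s)⁻¹ := by
    intro s
    have := congrArg π (hS1 s)
    rw [hπ_mul, hπ_mul] at this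
    exact eq_inv_of_mul_eq_one_right (mul_eq_right.1 this)
  have hδn : ∀ s, ‖δ s‖ = 1 := by
    intro s
    simpa using hLn {s} (fun _ => 1)
  -- unit
  have hG1 : δG 1 = 1 := by
    have : ContinuousLinearMap.mul ℂ LG (δG 1) = ContinuousLinearMap.id ℂ LG := by
      apply ContinuousLinearMap.ext_on hGd
      rintro _ ⟨g, rfl⟩
      simp [hGm]
    have := congrArg (fun T : LG →L[ℂ] LG => T 1) this
    simpa using this
  -- module facts
  have hmod : ∀ m, (∀ a b w, lW m a (lW m b w) = lW m (a * b) w) ∧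
      (∀ a b w, rW m (rW m w a) b = rW m w (a * b)) ∧
      (∀ a b w, lW m a (rW m w b) = rW m (lW m a w) b) ∧
      (∀ a b w, θ a = θ b → lW m a w = lW m b w) ∧
      (∀ a b w, θ a = θ b → rW m w a = rW m w b) ∧
      (∀ a w, θ a = 1 → lW m a w = w) ∧ (∀ a w, θ a = 1 → rW m w a = w) := by
    intro m
    induction m with
    | zero =>
      refine ⟨?_, ?_, ?_, ?_, ?_, ?_, ?_⟩
      · intro a b w; apply ψ0.injective; simp [hlW0, hθ_mul, mul_assoc]
      · intro a b w; apply ψ0.injective; simp [hrW0, hθ_mul, mul_assoc]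
      · intro a b w; apply ψ0.injective; simp [hlW0, hrW0, mul_assoc]
      · intro a b w h; apply ψ0.injective; simp [hlW0, h]
      · intro a b w h; apply ψ0.injective; simp [hrW0, h]
      · intro a w h; apply ψ0.injective; simp [hlW0, h]
      · intro a w h; apply ψ0.injective; simp [hrW0, h]
    | succ m ih =>
      obtain ⟨i1, i2, i3, i4, i5, i6, i7⟩ := ih
      refine ⟨?_, ?_, ?_, ?_, ?_, ?_, ?_⟩
      · intro a b w; apply (eD m).injective; ext x; rw [hlWsucc, hlWsucc, hlWsucc, i2]
      · intro a b w; apply (eD m).injective; ext x; rw [hrWsucc, hrWsucc, hrWsucc, i1]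
      · intro a b w; apply (eD m).injective; ext x; rw [hlWsucc, hrWsucc, hrWsucc, hlWsucc, i3]
      · intro a b w h; apply (eD m).injective; ext x; rw [hlWsucc, hlWsucc, i5 a b x h]
      · intro a b w h; apply (eD m).injective; ext x; rw [hrWsucc, hrWsucc, i4 a b x h]
      · intro a w h; apply (eD m).injective; ext x; rw [hlWsucc, i7 a x h]
      · intro a w h; apply (eD m).injective; ext x; rw [hrWsucc, i6 a x h]
  -- cones
  have hcone : ∀ k, ∃ C : Set (W (k + 1)).carrier, OCone C ∧
      (∀ s, ∀ c ∈ C, lW (k + 1) (δ s) c ∈ C) ∧ (∀ s, ∀ c ∈ C, rW (k + 1) c (δ s) ∈ C) ∧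
      (Even k → OUnit C) ∧ (¬ Even k → LFun C) := by
    intro k
    induction k with
    | zero =>
      let ev : G → (W 1).carrier →ₗ[ℂ] ℂ := fun g =>
        { toFun := fun φ => eD 0 φ (ψ0.symm (δG g))
          map_add' := by intro a b; simp
          map_smul' := by intro a b; simp }
      have hev : ∀ g φ, ev g φ = eD 0 φ (ψ0.symm (δG g)) := fun _ _ => rfl
      have hδG : ∀ g, ‖δG g‖ = 1 := by
        intro s
        simpa using hGn {s} (fun _ => 1)
      obtain ⟨b1, b2⟩ := OCone.base ev
        (by
          intro g φ
          rw [hev]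
          refine ((eD 0 φ).le_opNorm _).trans ?_
          simp [hδG])
        (by
          intro φ M hM hg
          rw [← (eD 0).norm_map]
          apply ContinuousLinearMap.opNorm_le_bound _ hM
          intro w
          have := l1_norm δG hGn hGd ((eD 0 φ).comp
            (ψ0.symm.toContinuousLinearEquiv : LG →L[ℂ] (W 0).carrier)) M hg (ψ0 w)
          simpa using this)
        (by
          intro u M hM
          obtain ⟨φ, hφ⟩ := l1_exists δG hGn u M ((norm_nonneg _).trans (hM 1)) hM
          refine ⟨(eD 0).symm (φ.comp (ψ0.toContinuousLinearEquiv : (W 0).carrier →L[ℂ] LG)), ?_⟩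
          intro g
          rw [hev]
          simp [hφ])
      refine ⟨_, b1, ?_, ?_, fun _ => b2, fun h => absurd Even.zero h⟩
      · intro s c hc g
        have h1 : rW 0 (ψ0.symm (δG g)) (δ s) = ψ0.symm (δG (g * π s)) := by
          apply ψ0.injective; simp [hrW0, hθδ, hGm]
        rw [hev, hlWsucc, h1]
        exact hc (g * π s)
      · intro s c hc g
        have h1 : lW 0 (δ s) (ψ0.symm (δG g)) = ψ0.symm (δG (π s * g)) := by
          apply ψ0.injective; simp [hlW0, hθδ, hGm]
        rw [hev, hrWsucc, h1]
        exact hc (π s * g)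
    | succ k ih =>
      obtain ⟨C, hC, hl, hr, hE, hO⟩ := ih
      refine ⟨dualCone (eD (k + 1)) C, hC.dual _, ?_, ?_, ?_, ?_⟩
      · intro s φ hφ c hc
        rw [hlWsucc]
        exact hφ _ (hr s c hc)
      · intro s φ hφ c hc
        rw [hrWsucc]
        exact hφ _ (hl s c hc)
      · intro h
        exact LFun.dual (hO (by rwa [Nat.even_add_one] at h)) _
      · intro h
        exact OUnit.dual hC (hE (by rwa [Nat.even_add_one, not_not] at h)) _
  obtain ⟨C, hC, hCl, hCr, hCu, -⟩ := hcone (2 * n)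
  have hCu := hCu (even_two_mul n)
  obtain ⟨i1, i2, i3, i4, i5, i6, i7⟩ := hmod (2 * n + 1)
  set l := lW (2 * n + 1)
  set r := rW (2 * n + 1)
  -- `D` vanishes on `J`
  have z4 : ∀ a w, θ a = 0 → l a w = 0 := by
    intro a w h
    rw [i4 a 0 w (by rw [h, map_zero])]; simp
  have z5 : ∀ a w, θ a = 0 → r w a = 0 := by
    intro a w h
    rw [i5 a 0 w (by rw [h, map_zero])]; simp
  have hDJ : ∀ x ∈ J, D x = 0 := by
    obtain ⟨⟨hJc, hJl, hJr⟩, hJs, hJmin⟩ := hJ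
    have hle : J ≤ J ⊓ LinearMap.ker (D : L →ₗ[ℂ] (W (2 * n + 1)).carrier) := by
      apply hJmin
      · refine ⟨?_, ?_, ?_⟩
        · have : IsClosed {x : L | D x = 0} := isClosed_eq D.continuous continuous_const
          exact hJc.inter this
        · rintro a x ⟨hx, hx0⟩
          refine ⟨hJl a x hx, ?_⟩
          have hx0 : D x = 0 := hx0
          change D (a * x) = 0
          rw [hD, hx0, z5 x _ ((hθ_ker x).2 hx)]; simp
        · rintro x a ⟨hx, hx0⟩
          refine ⟨hJr x a hx, ?_⟩
          have hx0 : D x = 0 := hx0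
          change D (x * a) = 0
          rw [hD, hx0, z4 x _ ((hθ_ker x).2 hx)]; simp
      · rintro x ⟨s, t, e, he, rfl⟩
        refine ⟨hJs ⟨s, t, e, he, rfl⟩, ?_⟩
        change D (δ (s * e * t) - δ (s * t)) = 0
        have h1 : D (δ (s * e)) = D (δ s) := by
          have := hDE (δ s) (δE ⟨e, he⟩)
          rw [hκδ, hf_one, one_smul, hLm] at this
          exact this
        have h2 : θ (δ (s * e)) = θ (δ s) := by
          rw [hθδ, hθδ, hπ_mul, hπe e he, mul_one]
        rw [map_sub, ← hLm (s * e) t, ← hLm s t, hD, hD, h1, i4 _ _ _ h2, sub_self]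
    intro x hx
    exact (hle hx).2
  have hDπ : ∀ s t, π s = π t → D (δ s) = D (δ t) := by
    intro s t h
    have := hDJ _ ((hπ_rel s t).1 h)
    rwa [map_sub, sub_eq_zero] at this
  have hθπ : ∀ s t, π s = π t → θ (δ s) = θ (δ t) := by
    intro s t h
    rw [hθδ, hθδ, h]
  -- section
  obtain ⟨σ, hσ⟩ := hπ_surj.hasRightInverse
  have hσ : ∀ g, π (σ g) = g := hσ
  let A : G → (W (2 * n + 1)).carrier →ₗ[ℂ] (W (2 * n + 1)).carrier := fun g =>
    { toFun := fun v => l (δ (σ g)) (r v (δ (σ g⁻¹)))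
      map_add' := by intro a b; simp
      map_smul' := by intro a b; simp }
  have hA : ∀ g v, A g v = l (δ (σ g)) (r v (δ (σ g⁻¹))) := fun _ _ => rfl
  obtain ⟨w, hw⟩ := hC.fixed hCu A
    (by
      intro v
      rw [hA, i6, i7] <;> simp [hθδ, hσ, hG1])
    (by
      intro g k v
      rw [hA, hA, hA, ← i3, i1, i2, hLm, hLm]
      rw [i4 (δ (σ (g * k))) (δ (σ g * σ k)) _ (hθπ _ _ (by simp [hσ, hπ_mul])),
        i5 (δ (σ (g * k)⁻¹)) (δ (σ k⁻¹ * σ g⁻¹)) _ (hθπ _ _ (by simp [hσ, hπ_mul]))])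
    (by
      intro g c hc
      exact hCl _ _ (hCr _ _ hc))
    (fun g => r (D (δ (σ g))) (δ (σ g⁻¹))) (‖r‖ * ‖D‖)
    (by
      intro g
      refine ((r _).le_opNorm _).trans ?_
      rw [hδn, mul_one]
      refine (r.le_opNorm _).trans ?_
      gcongr
      refine (D.le_opNorm _).trans ?_
      rw [hδn, mul_one])
    (by
      intro g k
      rw [hA]
      rw [hDπ (σ (g * k)) (σ g * σ k) (by simp [hσ, hπ_mul]), ← hLm, hD, map_add,
        _root_.add_apply]
      congr 1
      · rw [i2, hLm, ← i3]
        rw [i5 (δ (σ (g * k)⁻¹)) (δ (σ k⁻¹ * σ g⁻¹)) _ (hθπ _ _ (by simp [hσ, hπ_mul]))]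
      · rw [i2, hLm]
        exact i5 _ _ _ (hθπ _ _ (by simp [hσ, hπ_mul])))
  refine ⟨-w, ?_⟩
  have hfin : D = (r w : L →L[ℂ] (W (2 * n + 1)).carrier) - (l.flip w) := by
    apply ContinuousLinearMap.ext_on hLd
    rintro _ ⟨s, rfl⟩
    have h1 := congrArg (fun v => r v (δ s)) (hw (π s))
    simp only [hA] at h1
    rw [map_sub, _root_.sub_apply, ← i3, i2, i2, hLm] at h1
    have h2 : θ (δ (σ (π s)⁻¹ * s)) = 1 := by
      rw [hθδ, hπ_mul, hσ, inv_mul_cancel, hG1]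
    rw [i7 _ _ h2, i7 _ _ h2, hDπ (σ (π s)) s (hσ _), i4 _ _ _ (hθπ (σ (π s)) s (hσ _))] at h1
    rw [h1]; rfl
  intro a
  conv_lhs => rw [hfin]
  simp only [_root_.sub_apply, ContinuousLinearMap.flip_apply, map_neg, _root_.neg_apply]
  abel
end
end
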